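/- With f₀, h, Ω as in the context, let C̃ > 0 and M > 0. Suppose φ : Ω → ℝ is continuous with 0 ≤ φ(w,y) ≤ C̃·e^{−w^{4/3}} for all (w,y) ∈ Ω, and suppose u is a real-valued function on the closure of Ω in ℝ×T³ such that: 0 ≤ u ≤ M everywhere; u = 0 on the boundary ∂Ω; u extends to a twice continuously differentiable function on an open neighborhood of cl(Ω) ∩ {(w,y) : w > w₂} in ℝ×T³; and −Δu = φ on Ω ∩ {(w,y) : w > w₂}, where Δ is the Laplacian in all four variables. Then for every (w,y) ∈ Ω with w ≥ w₆ one has u(w,y) ≤ (9e/32)·C̃·w^{−2/3}·e^{−w^{4/3}} + e⁴·M·e^{−2·w^{4/3}}. -/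

import Mathlib

open Real MeasureTheory

noncomputable section

/-- `w_k = (27/8)·k^{3/2}`. -/
def wseq (k : ℕ) : ℝ := (27 / 8) * (k : ℝ) ^ ((3 : ℝ) / 2)

/-- The properties of the fixed cutoff function `ζ`: smooth, `ζ = 0` on `(-∞,0]`,
`ζ = 1` on `[1,∞)`, `0 ≤ ζ ≤ 1`, `ζ' > 0` on `(0,1)`, and `ζ(t) + ζ(1-t) = 1`. -/
def IsCutoff (ζ : ℝ → ℝ) : Prop :=
  ContDiff ℝ (⊤ : ℕ∞) ζ ∧ (∀ t : ℝ, t ≤ 0 → ζ t = 0) ∧ (∀ t : ℝ, 1 ≤ t → ζ t = 1) ∧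
    (∀ t : ℝ, ζ t ∈ Set.Icc (0 : ℝ) 1) ∧ (∀ t ∈ Set.Ioo (0 : ℝ) 1, 0 < deriv ζ t) ∧
    (∀ t : ℝ, ζ t + ζ (1 - t) = 1)

/-- The properties of the fixed sequence `(a_k)` in `ℤ³`:
`|a_k|² = 4k+1` and `|a_k · a_{k+1}| ≤ |a_k||a_{k+1}|/√3` for all `k ≥ 1`. -/
def IsGoodSeq (a : ℕ → Fin 3 → ℤ) : Prop :=
  ∀ k : ℕ, 1 ≤ k →
    ((∑ i : Fin 3, (a k i) ^ 2 = 4 * (k : ℤ) + 1) ∧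
      |∑ i : Fin 3, ((a k i : ℝ) * (a (k + 1) i : ℝ))| ≤
        Real.sqrt (∑ i : Fin 3, (a k i : ℝ) ^ 2) *
          Real.sqrt (∑ i : Fin 3, (a (k + 1) i : ℝ) ^ 2) / Real.sqrt 3)

/-- The function `f₀(w,y) = Σ_{k≥2} ζ((w-w_{k-1})/(w_k-w_{k-1}))·ζ((w_{k+1}-w)/(w_{k+1}-w_k))·cos(a_k·y)`
(a locally finite sum), `2π`-periodic in each coordinate of `y`. -/
def f0 (ζ : ℝ → ℝ) (a : ℕ → Fin 3 → ℤ) (w : ℝ) (y : Fin 3 → ℝ) : ℝ :=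
  ∑' k : ℕ, if 2 ≤ k then
      ζ ((w - wseq (k - 1)) / (wseq k - wseq (k - 1))) *
        ζ ((wseq (k + 1) - w) / (wseq (k + 1) - wseq k)) *
        Real.cos (∑ i : Fin 3, (a k i : ℝ) * y i)
    else 0

/-- `h = (2e)^{-10}`. -/
def hSmall : ℝ := 1 / (2 * Real.exp 1) ^ 10

/-- `Ω = {(w,y) : w ≥ w₂, |f₀(w,y)| < 2h}`, viewed as the (2π-periodic in `y`)
subset of `ℝ × ℝ³` corresponding to a subset of `ℝ × T³`. -/
def OmegaSet (ζ : ℝ → ℝ) (a : ℕ → Fin 3 → ℤ) : Set (ℝ × (Fin 3 → ℝ)) :=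
  {p | wseq 2 ≤ p.1 ∧ |f0 ζ a p.1 p.2| < 2 * hSmall}

end

noncomputable section
open Real MeasureTheory

/-- The Laplacian in all four variables `(w, y)` of a function on `ℝ × ℝ³`. -/
def cylLaplacian3 (F : ℝ × (Fin 3 → ℝ) → ℝ) (p : ℝ × (Fin 3 → ℝ)) : ℝ :=
  deriv (deriv (fun t => F (t, p.2))) p.1 +
    ∑ i : Fin 3, deriv (deriv (fun t => F (p.1, Function.update p.2 i t))) (p.2 i)

/-- A function on `ℝ × ℝ³` is `2π`-periodic in each coordinate of `y`,
i.e. descends to `ℝ × T³`. -/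
def cylPeriodic3 (u : ℝ × (Fin 3 → ℝ) → ℝ) : Prop :=
  ∀ (p : ℝ × (Fin 3 → ℝ)) (i : Fin 3),
    u (p.1, Function.update p.2 i (p.2 i + 2 * π)) = u p

lemma wseq_strictMono : StrictMono wseq := by
  intro m n hmn
  unfold wseq
  have h : ((m : ℝ)) ^ ((3 : ℝ) / 2) < (n : ℝ) ^ ((3 : ℝ) / 2) :=
    Real.rpow_lt_rpow (Nat.cast_nonneg m) (by exact_mod_cast hmn) (by norm_num)
  linarith

lemma wseq_rpow_two_thirds (k : ℕ) : wseq k ^ ((2 : ℝ) / 3) = 9 / 4 * k := by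
  have h : ((27 : ℝ) / 8) ^ ((2 : ℝ) / 3) = 9 / 4 := by
    rw [show (27 : ℝ) / 8 = (3 / 2) ^ (3 : ℝ) by norm_num, ← Real.rpow_mul (by norm_num)]
    norm_num
  unfold wseq
  rw [Real.mul_rpow (by norm_num) (by positivity), h, ← Real.rpow_mul (Nat.cast_nonneg k)]
  norm_num

lemma wseq_rpow_four_thirds (k : ℕ) : wseq k ^ ((4 : ℝ) / 3) = 81 / 16 * (k : ℝ) ^ 2 := by
  have h0 : 0 ≤ wseq k := by unfold wseq; positivity
  rw [show (4 : ℝ) / 3 = 2 / 3 * (2 : ℕ) by norm_num, Real.rpow_mul_natCast h0,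
    wseq_rpow_two_thirds]
  ring

lemma exists_wseq_le_le {w : ℝ} (hw : wseq 2 ≤ w) :
    ∃ k : ℕ, 2 ≤ k ∧ wseq k ≤ w ∧ w ≤ wseq (k + 1) := by
  have hex : ∃ n : ℕ, w < wseq n := by
    obtain ⟨n, hn⟩ := exists_nat_gt (max w 1)
    refine ⟨n, ?_⟩
    have h1 : (1 : ℝ) ≤ n := (le_max_right _ _).trans hn.le
    have h2 : (n : ℝ) ^ (1 : ℝ) ≤ (n : ℝ) ^ ((3 : ℝ) / 2) :=
      Real.rpow_le_rpow_of_exponent_le h1 (by norm_num)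
    rw [Real.rpow_one] at h2
    have := (le_max_left w 1).trans_lt hn
    unfold wseq
    linarith
  classical
  have hlt := Nat.find_spec hex
  have h3 : 2 < Nat.find hex := by
    by_contra hle
    have := wseq_strictMono.monotone (not_lt.mp hle)
    linarith
  refine ⟨Nat.find hex - 1, by omega, ?_, ?_⟩
  · exact not_lt.mp (Nat.find_min hex (by omega))
  · rw [Nat.sub_add_cancel (by omega)]
    exact hlt.le

lemma f0_eq_add {ζ : ℝ → ℝ} (hζ : IsCutoff ζ) (a : ℕ → Fin 3 → ℤ) {k : ℕ} (hk : 2 ≤ k) {w : ℝ}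
    (hw : wseq k ≤ w) (hw' : w ≤ wseq (k + 1)) :
    ∃ α β : ℝ, 0 ≤ α ∧ 0 ≤ β ∧ α + β = 1 ∧ ∀ y : Fin 3 → ℝ,
      f0 ζ a w y = α * Real.cos (∑ i, (a k i : ℝ) * y i) +
        β * Real.cos (∑ i, (a (k + 1) i : ℝ) * y i) := by
  obtain ⟨-, hζ0, hζ1, hζI, -, hζs⟩ := hζ
  have hpos : ∀ m n : ℕ, m < n → 0 < wseq n - wseq m := fun m n h =>
    sub_pos.mpr (wseq_strictMono h)
  have hd := hpos k (k + 1) (Nat.lt_succ_self k)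
  refine ⟨ζ ((wseq (k + 1) - w) / (wseq (k + 1) - wseq k)),
    ζ ((w - wseq k) / (wseq (k + 1) - wseq k)), (hζI _).1, (hζI _).1, ?_, fun y => ?_⟩
  · rw [← hζs ((wseq (k + 1) - w) / (wseq (k + 1) - wseq k))]
    congr 2
    field_simp
    ring
  · unfold f0
    rw [tsum_eq_sum (s := {k, k + 1}), Finset.sum_pair (by omega), if_pos hk, if_pos (by omega)]
    · have e1 : ζ ((w - wseq (k - 1)) / (wseq k - wseq (k - 1))) = 1 := by
        apply hζ1
        rw [le_div_iff₀ (hpos _ _ (by omega))]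
        linarith
      have e2 : ζ ((wseq (k + 1 + 1) - w) / (wseq (k + 1 + 1) - wseq (k + 1))) = 1 := by
        apply hζ1
        rw [le_div_iff₀ (hpos _ _ (by omega))]
        linarith
      rw [e1, e2, Nat.add_sub_cancel]
      ring
    · intro j hj
      simp only [Finset.mem_insert, Finset.mem_singleton, not_or] at hj
      split_ifs with h2
      · rcases lt_or_gt_of_ne hj.1 with hlt | hgt
        · have : ζ ((wseq (j + 1) - w) / (wseq (j + 1) - wseq j)) = 0 := by
            apply hζ0
            apply div_nonpos_of_nonpos_of_nonneg _ (hpos _ _ (by omega)).le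
            have := wseq_strictMono.monotone (show j + 1 ≤ k by omega)
            linarith
          rw [this]
          ring
        · have : ζ ((w - wseq (j - 1)) / (wseq j - wseq (j - 1))) = 0 := by
            apply hζ0
            apply div_nonpos_of_nonpos_of_nonneg _ (hpos _ _ (by omega)).le
            have := wseq_strictMono.monotone (show k + 1 ≤ j - 1 by omega)
            linarith
          rw [this]
          ring
      · rfl

lemma two_mul_sin_sq_le_abs_cos_sub_cos {m : ℤ} {x y : ℝ} (hx : m * π ≤ x) (hxy : x ≤ y)
    (hy : y ≤ (m + 1) * π) : 2 * Real.sin ((y - x) / 2) ^ 2 ≤ |Real.cos x - Real.cos y| := by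
  obtain ⟨s, rfl⟩ : ∃ s, x = s + m * π := ⟨x - m * π, by ring⟩
  obtain ⟨t, rfl⟩ : ∃ t, y = t + m * π := ⟨y - m * π, by ring⟩
  have hs : 0 ≤ s := by linarith
  have hst : s ≤ t := by linarith
  have ht : t ≤ π := by linarith
  rw [Real.cos_add_int_mul_pi, Real.cos_add_int_mul_pi, ← mul_sub, abs_mul, abs_zpow, abs_neg,
    abs_one, one_zpow, one_mul, show (t + m * π - (s + m * π)) / 2 = (t - s) / 2 by ring]
  have h0 : 0 ≤ Real.sin ((t - s) / 2) :=
    Real.sin_nonneg_of_nonneg_of_le_pi (by linarith) (by linarith)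
  have hprod : Real.cos s - Real.cos t = 2 * Real.sin ((t + s) / 2) * Real.sin ((t - s) / 2) := by
    rw [Real.cos_sub_cos, add_comm s t, ← neg_sub t s, neg_div, Real.sin_neg]
    ring
  have hle : Real.sin ((t - s) / 2) ≤ Real.sin ((t + s) / 2) := by
    rcases le_total ((t + s) / 2) (π / 2) with h | h
    · exact Real.sin_le_sin_of_le_of_le_pi_div_two (by linarith) h (by linarith)
    · rw [← Real.sin_pi_sub ((t + s) / 2)]
      exact Real.sin_le_sin_of_le_of_le_pi_div_two (by linarith) (by linarith) (by linarith)
  rw [hprod]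
  refine le_trans ?_ (le_abs_self _)
  nlinarith

lemma four_mul_hSmall_lt_sin_sq : 4 * hSmall < Real.sin (1 / 2300) ^ 2 := by
  have he : (2.718 : ℝ) < Real.exp 1 := lt_trans (by norm_num) Real.exp_one_gt_d9
  have h1 : (1 : ℝ) / 2300 - (1 / 2300) ^ 3 / 6 < Real.sin (1 / 2300) :=
    Real.sin_gt_sub_cube (by norm_num)
  have h2 : hSmall < 1 / (2 * 2.718) ^ 10 := by
    unfold hSmall
    gcongr
  have h3 : ((1 : ℝ) / 2300 - (1 / 2300) ^ 3 / 6) ^ 2 < Real.sin (1 / 2300) ^ 2 :=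
    pow_lt_pow_left₀ h1 (by norm_num) two_ne_zero
  refine lt_trans ?_ h3
  refine lt_trans (mul_lt_mul_of_pos_left h2 (by norm_num)) ?_
  norm_num

lemma sub_le_of_abs_cos_sub_cos_le {m : ℤ} {x y : ℝ} (hx : m * π ≤ x)
    (hy : y ≤ (m + 1) * π) (h : |Real.cos x - Real.cos y| ≤ 8 * hSmall) : y - x ≤ 1 / 1150 := by
  by_contra! hlt
  have h1 := two_mul_sin_sq_le_abs_cos_sub_cos hx (by linarith) hy
  have h2 : Real.sin (1 / 2300) ≤ Real.sin ((y - x) / 2) :=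
    Real.sin_le_sin_of_le_of_le_pi_div_two (by linarith [Real.pi_pos]) (by linarith) (by linarith)
  have h3 : 0 ≤ Real.sin (1 / 2300) :=
    Real.sin_nonneg_of_nonneg_of_le_pi (by norm_num) (by linarith [Real.pi_gt_three])
  have h4 := pow_le_pow_left₀ h3 h2 2
  have := four_mul_hSmall_lt_sin_sq
  linarith

lemma volume_le_of_forall_abs_cos_sub_cos_le {x₀ : ℝ} {S : Set ℝ}
    (hS : S ⊆ Set.Icc (-(1 / 2)) (1 / 2))
    (h : ∀ s ∈ S, ∀ t ∈ S,
      |Real.cos (x₀ + 3 / 10 * s) - Real.cos (x₀ + 3 / 10 * t)| ≤ 8 * hSmall) :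
    volume S ≤ ENNReal.ofReal (2 / 345) := by
  have hπ := Real.pi_gt_three
  set n : ℤ := ⌊(x₀ + 3 / 20) / π⌋ with hn
  have hn1 : n * π ≤ x₀ + 3 / 20 := by
    rw [← le_div_iff₀ Real.pi_pos]; exact Int.floor_le _
  have hn2 : x₀ + 3 / 20 < (n + 1) * π := by
    rw [← div_lt_iff₀ Real.pi_pos]; exact Int.lt_floor_add_one _
  have key : ∀ (m : ℤ) (T : Set ℝ), T ⊆ S →
      (∀ s ∈ T, m * π ≤ x₀ + 3 / 10 * s ∧ x₀ + 3 / 10 * s ≤ (m + 1) * π) →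
      volume T ≤ ENNReal.ofReal (1 / 345) := by
    intro m T hTS hT
    refine (Real.volume_le_diam T).trans (Metric.ediam_le fun s hs t ht => ?_)
    rw [edist_dist, Real.dist_eq]
    apply ENNReal.ofReal_le_ofReal
    rw [abs_le]
    have h1 := sub_le_of_abs_cos_sub_cos_le (hT s hs).1 (hT t ht).2 (h s (hTS hs) t (hTS ht))
    have h2 := sub_le_of_abs_cos_sub_cos_le (hT t ht).1 (hT s hs).2 (h t (hTS ht) s (hTS hs))
    constructor <;> linarith
  have hcover : S ⊆ {s ∈ S | n * π ≤ x₀ + 3 / 10 * s} ∪ {s ∈ S | x₀ + 3 / 10 * s ≤ n * π} :=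
    fun s hs => (le_total (n * π) (x₀ + 3 / 10 * s)).imp (fun h => ⟨hs, h⟩) (fun h => ⟨hs, h⟩)
  refine (measure_mono hcover).trans ((measure_union_le _ _).trans ?_)
  rw [show (2 : ℝ) / 345 = 1 / 345 + 1 / 345 by norm_num,
    ENNReal.ofReal_add (by norm_num) (by norm_num)]
  refine add_le_add (key n _ (fun _ hs => hs.1) ?_) (key (n - 1) _ (fun _ hs => hs.1) ?_)
  · rintro s ⟨hs, hs'⟩
    have := (hS hs).2
    exact ⟨hs', by linarith⟩
  · rintro s ⟨hs, hs'⟩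
    have := (hS hs).1
    push_cast
    exact ⟨by linarith, by linarith⟩

/-- A measurable set in the unit cube which is thin along every line in a direction `d` is small. -/
lemma volume_le_of_forall_line {E : Set (Fin 3 → ℝ)} (hE : MeasurableSet E)
    (hEI : E ⊆ Set.Icc (-1) 1) {d : Fin 3 → ℝ} (hd : ∀ i, |d i| ≤ 1) {m : ENNReal}
    (hm : ∀ y, volume {t : ℝ | t ∈ Set.Icc (-(1 / 2) : ℝ) (1 / 2) ∧ y + t • d ∈ E} ≤ m) :
    volume E ≤ 27 * m := by
  set I : Set ℝ := Set.Icc (-(1 / 2)) (1 / 2) with hI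
  set B : Set (Fin 3 → ℝ) := Set.Icc (fun _ => -(3 / 2)) (fun _ => 3 / 2) with hB
  set P : Set (ℝ × (Fin 3 → ℝ)) := {q | q.1 ∈ I ∧ q.2 + q.1 • d ∈ E} with hP
  have hPm : MeasurableSet P :=
    (measurableSet_Icc.preimage measurable_fst).inter
      (hE.preimage (measurable_snd.add (measurable_fst.smul_const d)))
  have h1 : (volume : Measure (ℝ × (Fin 3 → ℝ))) P = volume E := by
    rw [Measure.volume_eq_prod, Measure.prod_apply hPm]
    have : ∀ t : ℝ, volume (Prod.mk t ⁻¹' P) = I.indicator (fun _ => volume E) t := by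
      intro t
      by_cases ht : t ∈ I
      · rw [Set.indicator_of_mem ht]
        have : Prod.mk t ⁻¹' P = (fun y => y + t • d) ⁻¹' E := by
          ext y; simp [hP, ht]
        rw [this, measure_preimage_add_right]
      · rw [Set.indicator_of_notMem ht]
        have : Prod.mk t ⁻¹' P = ∅ := by
          ext y; simp [hP, ht]
        rw [this, measure_empty]
    rw [lintegral_congr this, lintegral_indicator measurableSet_Icc, setLIntegral_const,
      Real.volume_Icc]
    norm_num
  have h2 : (volume : Measure (ℝ × (Fin 3 → ℝ))) P ≤ ∫⁻ y, B.indicator (fun _ => m) y := by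
    rw [Measure.volume_eq_prod, Measure.prod_apply_symm hPm]
    refine lintegral_mono fun y => ?_
    by_cases hy : y ∈ B
    · rw [Set.indicator_of_mem hy]
      exact hm y
    · rw [Set.indicator_of_notMem hy]
      have : (fun t => (t, y)) ⁻¹' P = ∅ := by
        rw [Set.eq_empty_iff_forall_notMem]
        rintro t ⟨ht, htE⟩
        apply hy
        have hl := (hEI htE).1
        have hu := (hEI htE).2
        have hti : ∀ i, |t * d i| ≤ 1 / 2 := by
          intro i
          rw [abs_mul]
          have : |t| ≤ 1 / 2 := abs_le.mpr ht
          nlinarith [abs_nonneg t, abs_nonneg (d i), hd i]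
        refine ⟨fun i => ?_, fun i => ?_⟩
        · have := hl i
          have h3 := abs_le.mp (hti i)
          simp at this
          linarith
        · have := hu i
          have h3 := abs_le.mp (hti i)
          simp at this
          linarith
      rw [this, measure_empty]
  rw [← h1]
  refine h2.trans ?_
  rw [lintegral_indicator measurableSet_Icc, setLIntegral_const, Real.volume_Icc_pi, mul_comm]
  norm_num [Finset.prod_const]

/-- Two frequency vectors which are far from parallel admit a direction which is orthogonal to the
second one and along which the first one oscillates at a prescribed rate. -/
lemma exists_direction {a b : Fin 3 → ℝ} (hb : 0 < ∑ i, b i ^ 2)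
    (hab : (∑ i, a i * b i) ^ 2 ≤ 1 / 3 * (∑ i, a i ^ 2) * ∑ i, b i ^ 2) {L : ℝ} (hL : 0 < L)
    (hLa : L ^ 2 ≤ 2 / 3 * ∑ i, a i ^ 2) :
    ∃ d : Fin 3 → ℝ, ∑ i, b i * d i = 0 ∧ ∑ i, a i * d i = L ∧ ∀ i, |d i| ≤ 1 := by
  set A := ∑ i, a i ^ 2 with hA
  set B := ∑ i, b i ^ 2 with hB
  set c := ∑ i, a i * b i with hc
  set σ := A - c ^ 2 / B with hσ
  have hcB : c ^ 2 / B ≤ 1 / 3 * A := by rw [div_le_iff₀ hb]; exact hab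
  have hσL : L ^ 2 ≤ σ := by rw [hσ]; linarith
  have hσ0 : 0 < σ := lt_of_lt_of_le (by positivity) hσL
  have hlin : ∀ x : Fin 3 → ℝ, ∑ i, x i * (L / σ * (a i - c / B * b i)) =
      L / σ * (∑ i, x i * a i - c / B * ∑ i, x i * b i) := by
    intro x
    rw [mul_sub, Finset.mul_sum, Finset.mul_sum, Finset.mul_sum, ← Finset.sum_sub_distrib]
    exact Finset.sum_congr rfl fun i _ => by ring
  have hba : ∑ i, b i * a i = c := Finset.sum_congr rfl fun i _ => mul_comm _ _
  have hbb : ∑ i, b i * b i = B := Finset.sum_congr rfl fun i _ => (sq _).symm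
  have haa : ∑ i, a i * a i = A := Finset.sum_congr rfl fun i _ => (sq _).symm
  have hbd : ∑ i, b i * (L / σ * (a i - c / B * b i)) = 0 := by
    rw [hlin, hba, hbb, div_mul_cancel₀ _ hb.ne', sub_self, mul_zero]
  have had : ∑ i, a i * (L / σ * (a i - c / B * b i)) = L := by
    rw [hlin, haa, ← hc, show A - c / B * c = σ by rw [hσ]; ring, div_mul_cancel₀ _ hσ0.ne']
  refine ⟨fun i => L / σ * (a i - c / B * b i), hbd, had, fun i => ?_⟩
  have hsq : ∑ i, (L / σ * (a i - c / B * b i)) ^ 2 ≤ 1 := by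
    have : ∑ i, (L / σ * (a i - c / B * b i)) ^ 2 =
        L / σ * (∑ i, a i * (L / σ * (a i - c / B * b i)) -
          c / B * ∑ i, b i * (L / σ * (a i - c / B * b i))) := by
      rw [mul_sub, Finset.mul_sum, Finset.mul_sum, Finset.mul_sum, ← Finset.sum_sub_distrib]
      exact Finset.sum_congr rfl fun i _ => by ring
    rw [this, had, hbd, mul_zero, sub_zero, div_mul_eq_mul_div, div_le_one hσ0, ← sq]
    exact hσL
  rw [← sq_le_one_iff_abs_le_one]
  exact (Finset.single_le_sum (f := fun i => (L / σ * (a i - c / B * b i)) ^ 2)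
    (fun j _ => sq_nonneg _) (Finset.mem_univ i)).trans hsq

lemma volume_le_of_abs_cos_add_cos_lt_aux {a b : Fin 3 → ℝ} (hb : 0 < ∑ i, b i ^ 2)
    (hab : (∑ i, a i * b i) ^ 2 ≤ 1 / 3 * (∑ i, a i ^ 2) * ∑ i, b i ^ 2) {r : ℝ} (hr : 0 < r)
    (hra : (3 / 10 / r) ^ 2 ≤ 2 / 3 * ∑ i, a i ^ 2) {α β : ℝ} (hα : 1 / 2 ≤ α) (y₀ : Fin 3 → ℝ)
    {E : Set (Fin 3 → ℝ)} (hE : MeasurableSet E) (hEI : E ⊆ Set.Icc (-1) 1)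
    (hEf : ∀ z ∈ E, |α * Real.cos (∑ i, a i * (y₀ + r • z) i) +
      β * Real.cos (∑ i, b i * (y₀ + r • z) i)| < 2 * hSmall) :
    volume E ≤ 27 * ENNReal.ofReal (2 / 345) := by
  obtain ⟨d, hbd, had, hd⟩ := exists_direction hb hab (by positivity) hra
  refine volume_le_of_forall_line hE hEI hd fun y => ?_
  have hsum : ∀ (x : Fin 3 → ℝ) (t : ℝ), ∑ i, x i * (y₀ + r • (y + t • d)) i =
      ∑ i, x i * (y₀ + r • y) i + r * t * ∑ i, x i * d i := by
    intro x t
    rw [Finset.mul_sum, ← Finset.sum_add_distrib]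
    refine Finset.sum_congr rfl fun i _ => ?_
    simp
    ring
  have hval : ∀ t : ℝ, y + t • d ∈ E →
      |α * Real.cos (∑ i, a i * (y₀ + r • y) i + 3 / 10 * t) +
        β * Real.cos (∑ i, b i * (y₀ + r • y) i)| < 2 * hSmall := by
    intro t ht
    have := hEf _ ht
    rwa [hsum, hsum, had, hbd, mul_zero, add_zero,
      show r * t * (3 / 10 / r) = 3 / 10 * t by field_simp] at this
  refine volume_le_of_forall_abs_cos_sub_cos_le (x₀ := ∑ i, a i * (y₀ + r • y) i)
    (fun t ht => ht.1) fun s hs t ht => ?_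
  have h1 := abs_lt.mp (hval s hs.2)
  have h2 := abs_lt.mp (hval t ht.2)
  rw [abs_le]
  constructor <;> by_contra! hcon <;> nlinarith

lemma volume_le_of_abs_cos_add_cos_lt {a b : Fin 3 → ℝ} (ha : 0 < ∑ i, a i ^ 2)
    (hb : 0 < ∑ i, b i ^ 2)
    (hab : (∑ i, a i * b i) ^ 2 ≤ 1 / 3 * (∑ i, a i ^ 2) * ∑ i, b i ^ 2) {r : ℝ} (hr : 0 < r)
    (hra : (3 / 10 / r) ^ 2 ≤ 2 / 3 * ∑ i, a i ^ 2)
    (hrb : (3 / 10 / r) ^ 2 ≤ 2 / 3 * ∑ i, b i ^ 2) {α β : ℝ} (hαβ : α + β = 1)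
    (y₀ : Fin 3 → ℝ) {E : Set (Fin 3 → ℝ)} (hE : MeasurableSet E) (hEI : E ⊆ Set.Icc (-1) 1)
    (hEf : ∀ z ∈ E, |α * Real.cos (∑ i, a i * (y₀ + r • z) i) +
      β * Real.cos (∑ i, b i * (y₀ + r • z) i)| < 2 * hSmall) :
    volume E ≤ 27 * ENNReal.ofReal (2 / 345) := by
  rcases le_total (1 / 2) α with hα | hα
  · exact volume_le_of_abs_cos_add_cos_lt_aux hb hab hr hra hα y₀ hE hEI hEf
  · refine volume_le_of_abs_cos_add_cos_lt_aux ha (a := b) (α := β) (β := α) ?_ hr hrb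
      (by linarith) y₀ hE hEI fun z hz => ?_
    · have : ∑ i, b i * a i = ∑ i, a i * b i := Finset.sum_congr rfl fun i _ => mul_comm _ _
      rw [this]
      linarith
    · rw [add_comm]
      exact hEf z hz

lemma volume_slice_le {ζ : ℝ → ℝ} (hζ : IsCutoff ζ) {a : ℕ → Fin 3 → ℤ} (ha : IsGoodSeq a)
    {w₀ w : ℝ} (hw₀ : 0 < w₀) (hw : wseq 2 ≤ w) (hww : 4 / 5 * w₀ ≤ w) (y₀ : Fin 3 → ℝ)
    {E : Set (Fin 3 → ℝ)} (hE : MeasurableSet E) (hEI : E ⊆ Set.Icc (-1) 1)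
    (hEf : ∀ z ∈ E, |f0 ζ a w (y₀ + (3 / 8 * w₀ ^ (-(1 : ℝ) / 3)) • z)| < 2 * hSmall) :
    volume E ≤ 27 * ENNReal.ofReal (2 / 345) := by
  obtain ⟨k, hk, hwk, hwk'⟩ := exists_wseq_le_le hw
  obtain ⟨α, β, -, -, hαβ, hf⟩ := f0_eq_add hζ a hk hwk hwk'
  have hk2 : (2 : ℝ) ≤ k := by exact_mod_cast hk
  have hA : ∀ j : ℕ, 1 ≤ j → ∑ i, ((a j i : ℝ)) ^ 2 = 4 * (j : ℝ) + 1 := fun j hj => by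
    exact_mod_cast congrArg (Int.cast : ℤ → ℝ) (ha j hj).1
  have hA0 := hA k (by omega)
  have hA1 := hA (k + 1) (by omega)
  push_cast at hA1
  have hr : 0 < 3 / 8 * w₀ ^ (-(1 : ℝ) / 3) := by positivity
  have hrk : (3 / 10 / (3 / 8 * w₀ ^ (-(1 : ℝ) / 3))) ^ 2 ≤ 2 / 3 * (4 * (k : ℝ) + 1) := by
    have h1 : (w₀ ^ (-(1 : ℝ) / 3))⁻¹ ^ 2 = w₀ ^ ((2 : ℝ) / 3) := by
      rw [← Real.rpow_neg hw₀.le, ← Real.rpow_natCast, ← Real.rpow_mul hw₀.le]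
      norm_num
    have h2 : (4 / 5 * w₀) ^ ((2 : ℝ) / 3) ≤ 9 / 4 * (k + 1) := by
      have := wseq_rpow_two_thirds (k + 1)
      push_cast at this
      rw [← this]
      exact Real.rpow_le_rpow (by positivity) (hww.trans hwk') (by norm_num)
    have h3 : (4 : ℝ) / 5 ≤ (4 / 5) ^ ((2 : ℝ) / 3) :=
      Real.self_le_rpow_of_le_one (by norm_num) (by norm_num) (by norm_num)
    rw [Real.mul_rpow (by norm_num) hw₀.le] at h2
    have h4 : 0 ≤ w₀ ^ ((2 : ℝ) / 3) := by positivity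
    rw [show 3 / 10 / (3 / 8 * w₀ ^ (-(1 : ℝ) / 3)) = 4 / 5 * (w₀ ^ (-(1 : ℝ) / 3))⁻¹ by
      field_simp; norm_num, mul_pow, h1]
    nlinarith
  refine volume_le_of_abs_cos_add_cos_lt (a := fun i => (a k i : ℝ))
    (b := fun i => (a (k + 1) i : ℝ)) ?_ ?_ ?_ hr ?_ ?_ hαβ y₀ hE hEI
    fun z hz => by rw [← hf]; exact hEf z hz
  · rw [hA0]; positivity
  · rw [hA1]; positivity
  · have h := (ha k (by omega)).2
    have hsq := pow_le_pow_left₀ (abs_nonneg _) h 2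
    rw [sq_abs, div_pow, mul_pow, Real.sq_sqrt (by positivity), Real.sq_sqrt (by positivity),
      Real.sq_sqrt (by norm_num)] at hsq
    linarith
  · rw [hA0]; exact hrk
  · rw [hA1]; linarith

lemma volume_le_of_forall_slice {E : Set (ℝ × (Fin 3 → ℝ))} (hE : MeasurableSet E)
    (hEI : ∀ z ∈ E, z.1 ∈ Set.Icc (-1 : ℝ) 1) {m : ENNReal}
    (hm : ∀ t ∈ Set.Icc (-1 : ℝ) 1, volume (Prod.mk t ⁻¹' E) ≤ m) : volume E ≤ 2 * m := by
  have h : volume E ≤ ∫⁻ t, (Set.Icc (-1 : ℝ) 1).indicator (fun _ => m) t := by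
    rw [Measure.volume_eq_prod, Measure.prod_apply hE]
    refine lintegral_mono fun t => ?_
    by_cases ht : t ∈ Set.Icc (-1 : ℝ) 1
    · rw [Set.indicator_of_mem ht]
      exact hm t ht
    · have : Prod.mk t ⁻¹' E = ∅ :=
        Set.eq_empty_iff_forall_notMem.mpr fun y hy => ht (hEI _ hy)
      rw [this, measure_empty]
      exact zero_le
  refine h.trans ?_
  rw [lintegral_indicator measurableSet_Icc, setLIntegral_const, Real.volume_Icc, mul_comm]
  norm_num

/-- The square of the Euclidean norm on `ℝ × ℝ³`. -/
def cylNormSq (z : ℝ × (Fin 3 → ℝ)) : ℝ := z.1 ^ 2 + ∑ i, z.2 i ^ 2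

/-- The kernel `(1 - |z|²)₊`. -/
def cylKernel (z : ℝ × (Fin 3 → ℝ)) : ℝ := max 0 (1 - cylNormSq z)

lemma continuous_cylNormSq : Continuous cylNormSq := by
  unfold cylNormSq
  fun_prop

lemma continuous_cylKernel : Continuous cylKernel :=
  continuous_const.max (continuous_const.sub continuous_cylNormSq)

lemma cylKernel_nonneg (z : ℝ × (Fin 3 → ℝ)) : 0 ≤ cylKernel z := le_max_left _ _

lemma cylNormSq_nonneg (z : ℝ × (Fin 3 → ℝ)) : 0 ≤ cylNormSq z := by
  unfold cylNormSq
  positivity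

lemma cylKernel_le_one (z : ℝ × (Fin 3 → ℝ)) : cylKernel z ≤ 1 :=
  max_le zero_le_one (by linarith [cylNormSq_nonneg z])

lemma cylKernel_eq_zero {z : ℝ × (Fin 3 → ℝ)} (hz : 1 ≤ cylNormSq z) : cylKernel z = 0 :=
  max_eq_left (by linarith)

lemma mem_Icc_of_cylNormSq_le_one {z : ℝ × (Fin 3 → ℝ)} (hz : cylNormSq z ≤ 1) :
    z ∈ Set.Icc (-1 : ℝ × (Fin 3 → ℝ)) 1 := by
  unfold cylNormSq at hz
  have h1 : |z.1| ≤ 1 := by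
    rw [← sq_le_one_iff_abs_le_one]
    linarith [Finset.sum_nonneg fun i (_ : i ∈ Finset.univ) => sq_nonneg (z.2 i)]
  have h2 : ∀ i, |z.2 i| ≤ 1 := fun i => by
    rw [← sq_le_one_iff_abs_le_one]
    have := Finset.single_le_sum (f := fun i => z.2 i ^ 2) (fun j _ => sq_nonneg _)
      (Finset.mem_univ i)
    linarith [sq_nonneg z.1]
  exact ⟨⟨(abs_le.mp h1).1, fun i => (abs_le.mp (h2 i)).1⟩,
    ⟨(abs_le.mp h1).2, fun i => (abs_le.mp (h2 i)).2⟩⟩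

lemma hasCompactSupport_of_cylNormSq {F : Type*} [Zero F] {f : ℝ × (Fin 3 → ℝ) → F}
    (hf : ∀ z, 1 < cylNormSq z → f z = 0) : HasCompactSupport f :=
  HasCompactSupport.intro (K := Set.Icc (-1) 1) isCompact_Icc fun z hz =>
    hf z (by by_contra! h; exact hz (mem_Icc_of_cylNormSq_le_one h))

lemma hasCompactSupport_cylKernel : HasCompactSupport cylKernel :=
  hasCompactSupport_of_cylNormSq fun _ hz => cylKernel_eq_zero hz.le

lemma integrable_cylKernel : Integrable cylKernel :=
  continuous_cylKernel.integrable_of_hasCompactSupport hasCompactSupport_cylKernel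

lemma le_integral_cylKernel : (133 / 100 : ℝ) ≤ ∫ z, cylKernel z := by
  set J : Set ℝ := Set.Icc (-(7 / 10)) (7 / 10) with hJ
  set g : ℝ → ℝ := J.indicator 1 with hg
  set g2 : ℝ → ℝ := J.indicator (fun t => t ^ 2) with hg2
  have hgi : Integrable g := (integrable_indicator_iff measurableSet_Icc).mpr (by
    exact (continuousOn_const (c := (1 : ℝ))).integrableOn_Icc)
  have hg2i : Integrable g2 := (integrable_indicator_iff measurableSet_Icc).mpr
    (by exact (continuous_pow 2).continuousOn.integrableOn_Icc)
  have hgint : ∫ t, g t = 7 / 5 := by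
    rw [hg, integral_indicator_one measurableSet_Icc]
    norm_num [hJ, Measure.real]
  have hg2int : ∫ t, g2 t = 343 / 1500 := by
    rw [hg2, integral_indicator measurableSet_Icc, integral_Icc_eq_integral_Ioc,
      ← intervalIntegral.integral_of_le (by norm_num), integral_pow]
    norm_num
  set G : Fin 3 → Fin 3 → ℝ → ℝ := fun i j => if j = i then g2 else g with hG
  have hGi : ∀ i j, Integrable (G i j) := by
    intro i j
    simp only [hG]
    split_ifs
    · exact hg2i
    · exact hgi
  have hP0 : Integrable (fun y : Fin 3 → ℝ => ∏ j, g (y j)) :=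
    Integrable.fintype_prod (fun _ => hgi)
  have hPi : ∀ i, Integrable (fun y : Fin 3 → ℝ => ∏ j, G i j (y j)) := fun i =>
    Integrable.fintype_prod (hGi i)
  have hI0 : ∫ y : Fin 3 → ℝ, ∏ j, g (y j) = (7 / 5) ^ 3 := by
    rw [integral_fintype_prod_volume_eq_prod (fun _ => g)]
    simp only [hgint, Finset.prod_const, Finset.card_univ, Fintype.card_fin]
  have hIi : ∀ i, ∫ y : Fin 3 → ℝ, ∏ j, G i j (y j) = (7 / 5) ^ 2 * (343 / 1500) := by
    intro i
    rw [integral_fintype_prod_volume_eq_prod (G i)]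
    fin_cases i <;> simp [hG, Fin.prod_univ_three, hgint, hg2int] <;> norm_num
  set H : ℝ × (Fin 3 → ℝ) → ℝ := fun z =>
    g z.1 * ∏ j, g (z.2 j) - g2 z.1 * ∏ j, g (z.2 j) - ∑ i, g z.1 * ∏ j, G i j (z.2 j) with hH
  have i1 : Integrable (fun z : ℝ × (Fin 3 → ℝ) => g z.1 * ∏ j, g (z.2 j)) := hgi.mul_prod hP0
  have i2 : Integrable (fun z : ℝ × (Fin 3 → ℝ) => g2 z.1 * ∏ j, g (z.2 j)) := hg2i.mul_prod hP0
  have i3 : ∀ i ∈ (Finset.univ : Finset (Fin 3)),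
    Integrable (fun z : ℝ × (Fin 3 → ℝ) => g z.1 * ∏ j, G i j (z.2 j)) :=
    fun i _ => hgi.mul_prod (hPi i)
  have i12 : Integrable (fun z : ℝ × (Fin 3 → ℝ) =>
      g z.1 * ∏ j, g (z.2 j) - g2 z.1 * ∏ j, g (z.2 j)) := i1.sub i2
  have hHi : Integrable H := i12.sub (integrable_finsetSum _ i3)
  have hHint : ∫ z, H z = (7 / 5) ^ 4 - 4 * ((7 / 5) ^ 3 * (343 / 1500)) := by
    have e1 : ∫ z : ℝ × (Fin 3 → ℝ), g z.1 * ∏ j, g (z.2 j) = (7 / 5) * (7 / 5) ^ 3 := by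
      rw [Measure.volume_eq_prod, integral_prod_mul g (fun y : Fin 3 → ℝ => ∏ j, g (y j)), hgint, hI0]
    have e2 : ∫ z : ℝ × (Fin 3 → ℝ), g2 z.1 * ∏ j, g (z.2 j) = (343 / 1500) * (7 / 5) ^ 3 := by
      rw [Measure.volume_eq_prod, integral_prod_mul g2 (fun y : Fin 3 → ℝ => ∏ j, g (y j)), hg2int, hI0]
    have e3 : ∀ i, ∫ z : ℝ × (Fin 3 → ℝ), g z.1 * ∏ j, G i j (z.2 j) =
        (7 / 5) * ((7 / 5) ^ 2 * (343 / 1500)) := by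
      intro i
      rw [Measure.volume_eq_prod, integral_prod_mul g (fun y : Fin 3 → ℝ => ∏ j, G i j (y j)), hgint, hIi]
    simp only [hH]
    rw [integral_sub i12 (integrable_finsetSum _ i3), integral_sub i1 i2,
      integral_finsetSum _ i3, e1, e2]
    simp only [e3]
    norm_num
  have hle : ∀ z, H z ≤ cylKernel z := by
    intro z
    by_cases hz : z.1 ∈ J ∧ ∀ j, z.2 j ∈ J
    · refine le_trans (le_of_eq ?_) (le_max_right _ _)
      have hG' : ∀ i j, G i j (z.2 j) = if j = i then z.2 j ^ 2 else 1 := by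
        intro i j
        simp only [hG]
        split_ifs <;> simp [hg, hg2, hz.2 j]
      simp only [hH, hG', Finset.prod_ite_eq', Finset.mem_univ, if_true]
      simp [hg, hg2, hz.1, hz.2, cylNormSq]
      ring
    · refine le_trans (le_of_eq ?_) (cylKernel_nonneg z)
      rw [not_and_or] at hz
      rcases hz with hz | hz
      · simp [hH, hg, hg2, hz]
      · push Not at hz
        obtain ⟨j, hj⟩ := hz
        have z1 : ∏ j, g (z.2 j) = 0 :=
          Finset.prod_eq_zero (Finset.mem_univ j) (by simp [hg, hj])
        have z2 : ∀ i, ∏ j, G i j (z.2 j) = 0 := fun i =>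
          Finset.prod_eq_zero (Finset.mem_univ j) (by
            simp only [hG]
            split_ifs <;> simp [hg, hg2, hj])
        simp [hH, z1, z2]
  refine le_trans ?_ (integral_mono hHi integrable_cylKernel hle)
  rw [hHint]
  norm_num

/-- The second derivative of `v` in the direction `e`. -/
def secondDirDeriv (v : ℝ × (Fin 3 → ℝ) → ℝ) (e x : ℝ × (Fin 3 → ℝ)) : ℝ :=
  fderiv ℝ (fun y => fderiv ℝ v y e) x e

/-- The Laplacian expressed through Fréchet derivatives. -/
def frechetLaplacian (v : ℝ × (Fin 3 → ℝ) → ℝ) (x : ℝ × (Fin 3 → ℝ)) : ℝ :=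
  secondDirDeriv v (1, 0) x + ∑ i, secondDirDeriv v (0, Pi.single i 1) x

lemma Filter.EventuallyEq.secondDirDeriv_eq {v v' : ℝ × (Fin 3 → ℝ) → ℝ} {x : ℝ × (Fin 3 → ℝ)}
    (h : v =ᶠ[nhds x] v') (e : ℝ × (Fin 3 → ℝ)) :
    secondDirDeriv v e x = secondDirDeriv v' e x := by
  unfold secondDirDeriv
  have : (fun y => fderiv ℝ v y e) =ᶠ[nhds x] fun y => fderiv ℝ v' y e :=
    (h.fderiv (𝕜 := ℝ)).mono fun y hy => by simp only [hy]
  rw [this.fderiv_eq]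

lemma Filter.EventuallyEq.frechetLaplacian_eq {v v' : ℝ × (Fin 3 → ℝ) → ℝ}
    {x : ℝ × (Fin 3 → ℝ)} (h : v =ᶠ[nhds x] v') : frechetLaplacian v x = frechetLaplacian v' x := by
  unfold frechetLaplacian
  simp only [h.secondDirDeriv_eq]

lemma hasDerivAt_max_zero_sq (t : ℝ) :
    HasDerivAt (fun t : ℝ => (max 0 t) ^ 2) (2 * max 0 t) t := by
  rcases lt_trichotomy t 0 with h | h | h
  · rw [max_eq_left h.le, mul_zero]
    refine (hasDerivAt_const t (0 : ℝ)).congr_of_eventuallyEq ?_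
    filter_upwards [Iio_mem_nhds h] with s hs
    rw [max_eq_left (le_of_lt hs)]
    norm_num
  · subst h
    rw [max_self, mul_zero]
    have h0 : (fun t : ℝ => t ^ 2) =o[nhds 0] fun t : ℝ => t := by
      simpa using Asymptotics.isLittleO_pow_id (𝕜 := ℝ) (n := 2) (by norm_num)
    rw [hasDerivAt_iff_isLittleO_nhds_zero]
    refine Asymptotics.IsBigO.trans_isLittleO ?_ h0
    refine Asymptotics.IsBigO.of_bound 1 (Filter.Eventually.of_forall fun s => ?_)
    have h1 : max 0 s ^ 2 ≤ |s| ^ 2 :=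
      pow_le_pow_left₀ (le_max_left _ _) (max_le (abs_nonneg s) (le_abs_self s)) 2
    simpa using h1
  · rw [max_eq_right h.le]
    have := hasDerivAt_pow 2 t
    refine HasDerivAt.congr_of_eventuallyEq (f := fun t : ℝ => t ^ 2) (by simpa using this) ?_
    filter_upwards [Ioi_mem_nhds h] with s hs
    rw [max_eq_right (le_of_lt hs)]

lemma hasFDerivAt_cylNormSq (z : ℝ × (Fin 3 → ℝ)) :
    HasFDerivAt cylNormSq ((2 * z.1) • ContinuousLinearMap.fst ℝ ℝ (Fin 3 → ℝ) +
      ∑ i, (2 * z.2 i) • (ContinuousLinearMap.proj (R := ℝ) (φ := fun _ : Fin 3 => ℝ) i).comp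
        (ContinuousLinearMap.snd ℝ ℝ (Fin 3 → ℝ))) z := by
  have h1 : HasFDerivAt (fun z : ℝ × (Fin 3 → ℝ) => z.1 ^ 2)
      ((2 * z.1) • ContinuousLinearMap.fst ℝ ℝ (Fin 3 → ℝ)) z := by
    simpa using (ContinuousLinearMap.fst ℝ ℝ (Fin 3 → ℝ)).hasFDerivAt (x := z) |>.pow 2
  have h2 : ∀ i, HasFDerivAt (fun z : ℝ × (Fin 3 → ℝ) => z.2 i ^ 2)
      ((2 * z.2 i) • (ContinuousLinearMap.proj (R := ℝ) (φ := fun _ : Fin 3 => ℝ) i).comp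
        (ContinuousLinearMap.snd ℝ ℝ (Fin 3 → ℝ))) z := fun i => by
    simpa using ((ContinuousLinearMap.proj (R := ℝ) (φ := fun _ : Fin 3 => ℝ) i).comp
        (ContinuousLinearMap.snd ℝ ℝ (Fin 3 → ℝ))).hasFDerivAt (x := z) |>.pow 2
  exact h1.add (HasFDerivAt.fun_sum fun i _ => h2 i)

lemma fderiv_cylNormSq_fst (z : ℝ × (Fin 3 → ℝ)) : fderiv ℝ cylNormSq z (1, 0) = 2 * z.1 := by
  rw [(hasFDerivAt_cylNormSq z).fderiv]
  simp

lemma fderiv_cylNormSq_single (z : ℝ × (Fin 3 → ℝ)) (i : Fin 3) :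
    fderiv ℝ cylNormSq z (0, Pi.single i 1) = 2 * z.2 i := by
  rw [(hasFDerivAt_cylNormSq z).fderiv]
  simp [Pi.single_apply]

lemma hasFDerivAt_cylKernel_sq (z : ℝ × (Fin 3 → ℝ)) :
    HasFDerivAt (fun z => cylKernel z ^ 2) ((-2 * cylKernel z) • fderiv ℝ cylNormSq z) z := by
  have h1 : HasFDerivAt (fun z => 1 - cylNormSq z) (-fderiv ℝ cylNormSq z) z :=
    (hasFDerivAt_cylNormSq z).differentiableAt.hasFDerivAt.const_sub 1
  have h2 := (hasDerivAt_max_zero_sq (1 - cylNormSq z)).comp_hasFDerivAt z h1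
  have h3 : (-2 * cylKernel z) • fderiv ℝ cylNormSq z =
      (2 * max 0 (1 - cylNormSq z)) • -fderiv ℝ cylNormSq z := by
    rw [smul_neg, ← neg_smul, cylKernel, neg_mul]
  rw [h3]
  exact h2

lemma fderiv_apply_eq_sum (L : ℝ × (Fin 3 → ℝ) →L[ℝ] ℝ) (z : ℝ × (Fin 3 → ℝ)) :
    L z = z.1 * L (1, 0) + ∑ i, z.2 i * L (0, Pi.single i 1) := by
  have hz : z = z.1 • ((1, 0) : ℝ × (Fin 3 → ℝ)) +
      ∑ i, z.2 i • ((0, Pi.single i 1) : ℝ × (Fin 3 → ℝ)) := by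
    ext j
    · simp [Prod.fst_sum]
    · simp [Prod.snd_sum, Pi.single_apply]
  conv_lhs => rw [hz]
  simp only [map_add, map_sum, map_smul, smul_eq_mul]

lemma hasCompactSupport_cylKernel_sq : HasCompactSupport fun z => cylKernel z ^ 2 :=
  hasCompactSupport_of_cylNormSq fun z hz => by rw [cylKernel_eq_zero hz.le]; norm_num

lemma ContDiff.continuous_secondDirDeriv {v : ℝ × (Fin 3 → ℝ) → ℝ} (hv : ContDiff ℝ 2 v)
    (e : ℝ × (Fin 3 → ℝ)) : Continuous (secondDirDeriv v e) := by
  have hfd : ContDiff ℝ 1 fun y => fderiv ℝ v y e :=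
    (hv.fderiv_right (m := 1) (by norm_num)).clm_apply contDiff_const
  exact (hfd.continuous_fderiv (by norm_num)).clm_apply continuous_const

lemma ContDiff.continuous_frechetLaplacian {v : ℝ × (Fin 3 → ℝ) → ℝ} (hv : ContDiff ℝ 2 v) :
    Continuous (frechetLaplacian v) :=
  (hv.continuous_secondDirDeriv _).add
    (continuous_finsetSum _ fun _ _ => hv.continuous_secondDirDeriv _)

lemma continuous_fderiv_cylNormSq_apply (e : ℝ × (Fin 3 → ℝ)) :
    Continuous fun z => fderiv ℝ cylNormSq z e := by
  have : ContDiff ℝ 1 cylNormSq := by unfold cylNormSq; fun_prop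
  exact (this.continuous_fderiv (by norm_num)).clm_apply continuous_const

section MeanValue

variable {v : ℝ × (Fin 3 → ℝ) → ℝ} (p : ℝ × (Fin 3 → ℝ)) (s : ℝ)

lemma ContDiff.continuous_fderiv_apply_add_smul (hv : ContDiff ℝ 2 v) :
    Continuous fun q : ℝ × (ℝ × (Fin 3 → ℝ)) => fderiv ℝ v (p + q.1 • q.2) q.2 := by
  have h : Continuous (fderiv ℝ v) := hv.continuous_fderiv (by norm_num)
  exact (h.comp (by fun_prop : Continuous fun q : ℝ × (ℝ × (Fin 3 → ℝ)) =>
    p + q.1 • q.2)).clm_apply continuous_snd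

lemma hasDerivAt_integral_mul_cylKernel (hv : ContDiff ℝ 2 v) :
    HasDerivAt (fun s => ∫ z, v (p + s • z) * cylKernel z)
      (∫ z, fderiv ℝ v (p + s • z) z * cylKernel z) s := by
  have hcont : ∀ x : ℝ, Continuous fun z => v (p + x • z) * cylKernel z := fun x =>
    (hv.continuous.comp (by fun_prop)).mul continuous_cylKernel
  have hcont' : Continuous fun q : ℝ × (ℝ × (Fin 3 → ℝ)) =>
      fderiv ℝ v (p + q.1 • q.2) q.2 * cylKernel q.2 :=
    (hv.continuous_fderiv_apply_add_smul p).mul (continuous_cylKernel.comp continuous_snd)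
  obtain ⟨K, hK⟩ := ((isCompact_closedBall s 1).prod
    (isCompact_Icc (a := (-1 : ℝ × (Fin 3 → ℝ))) (b := 1))).exists_bound_of_continuousOn
    hcont'.continuousOn
  refine (hasDerivAt_integral_of_dominated_loc_of_deriv_le (μ := volume) (s := Metric.closedBall s 1)
    (bound := (Set.Icc (-1 : ℝ × (Fin 3 → ℝ)) 1).indicator fun _ => K)
    (F := fun s z => v (p + s • z) * cylKernel z)
    (F' := fun s z => fderiv ℝ v (p + s • z) z * cylKernel z)
    (Metric.closedBall_mem_nhds s one_pos)
    (Filter.Eventually.of_forall fun x => (hcont x).aestronglyMeasurable)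
    ((hcont s).integrable_of_hasCompactSupport hasCompactSupport_cylKernel.mul_left)
    (by exact (hcont'.comp (Continuous.prodMk_right s)).aestronglyMeasurable) ?_ ?_ ?_).2
  · refine Filter.Eventually.of_forall fun z x hx => ?_
    by_cases hz : z ∈ Set.Icc (-1 : ℝ × (Fin 3 → ℝ)) 1
    · rw [Set.indicator_of_mem hz]
      exact hK (x, z) ⟨hx, hz⟩
    · rw [Set.indicator_of_notMem hz, cylKernel_eq_zero, mul_zero, norm_zero]
      by_contra! h
      exact hz (mem_Icc_of_cylNormSq_le_one h.le)
  · rw [integrable_indicator_iff measurableSet_Icc]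
    exact integrableOn_const isCompact_Icc.measure_ne_top
  · refine Filter.Eventually.of_forall fun z x _ => ?_
    have h1 : HasDerivAt (fun x : ℝ => p + x • z) z x := by
      simpa using ((hasDerivAt_id x).smul_const z).const_add p
    have h2 := (hv.differentiable (by norm_num) (p + x • z)).hasFDerivAt.comp_hasDerivAt x h1
    exact h2.mul_const _

lemma integral_fderiv_mul_fderiv_cylNormSq_mul_cylKernel (hv : ContDiff ℝ 2 v)
    (e : ℝ × (Fin 3 → ℝ)) :
    ∫ z, fderiv ℝ v (p + s • z) e * (fderiv ℝ cylNormSq z e * cylKernel z) =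
      s / 2 * ∫ z, secondDirDeriv v e (p + s • z) * cylKernel z ^ 2 := by
  have hfd : ContDiff ℝ 1 fun y => fderiv ℝ v y e :=
    (hv.fderiv_right (m := 1) (by norm_num)).clm_apply contDiff_const
  have hf : ContDiff ℝ 1 fun z => fderiv ℝ v (p + s • z) e :=
    hfd.comp (contDiff_const.add (contDiff_id.const_smul s))
  have hf' : ∀ z, fderiv ℝ (fun z => fderiv ℝ v (p + s • z) e) z e =
      s * secondDirDeriv v e (p + s • z) := by
    intro z
    have h1 : HasFDerivAt (fun z : ℝ × (Fin 3 → ℝ) => p + s • z)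
        (s • ContinuousLinearMap.id ℝ (ℝ × (Fin 3 → ℝ))) z :=
      ((hasFDerivAt_id z).const_smul s).const_add p
    have h2 := (hfd.differentiable (by norm_num) (p + s • z)).hasFDerivAt.comp z h1
    have h3 := h2.fderiv
    simp only [Function.comp_def] at h3
    rw [h3]
    simp [secondDirDeriv]
  have hg : Continuous fun z => cylKernel z ^ 2 := continuous_cylKernel.pow 2
  have hgs := hasCompactSupport_cylKernel_sq
  have hg' : ∀ z, fderiv ℝ (fun z => cylKernel z ^ 2) z e =
      -2 * (fderiv ℝ cylNormSq z e * cylKernel z) := fun z => by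
    rw [(hasFDerivAt_cylKernel_sq z).fderiv]
    simp
    ring
  have hqc := continuous_fderiv_cylNormSq_apply e
  have hD2 : Continuous fun z => fderiv ℝ (fun z => fderiv ℝ v (p + s • z) e) z e :=
    (hf.continuous_fderiv (by norm_num)).clm_apply continuous_const
  have hHaar : (volume : Measure (ℝ × (Fin 3 → ℝ))).IsAddHaarMeasure := by
    rw [Measure.volume_eq_prod]
    infer_instance
  have key := integral_mul_fderiv_eq_neg_fderiv_mul_of_integrable (μ := volume)
    (f := fun z => fderiv ℝ v (p + s • z) e) (g := fun z => cylKernel z ^ 2) (v := e)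
    ((hD2.mul hg).integrable_of_hasCompactSupport hgs.mul_left)
    (by
      simp only [hg']
      exact (hf.continuous.mul (continuous_const.mul
        (hqc.mul continuous_cylKernel))).integrable_of_hasCompactSupport
          (hasCompactSupport_cylKernel.mul_left.mul_left.mul_left))
    ((hf.continuous.mul hg).integrable_of_hasCompactSupport hgs.mul_left)
    (fun z _ => hf.differentiable (by norm_num) z)
    (fun z _ => (hasFDerivAt_cylKernel_sq z).differentiableAt)
  simp only [hg', hf', mul_left_comm _ (-2 : ℝ), mul_assoc s] at key
  rw [integral_const_mul, integral_const_mul] at key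
  linarith

lemma integral_fderiv_mul_cylKernel (hv : ContDiff ℝ 2 v) :
    ∫ z, fderiv ℝ v (p + s • z) z * cylKernel z =
      s / 4 * ∫ z, frechetLaplacian v (p + s • z) * cylKernel z ^ 2 := by
  have hgs := hasCompactSupport_cylKernel_sq
  have hqc := continuous_fderiv_cylNormSq_apply
  have hlin : Continuous fun z : ℝ × (Fin 3 → ℝ) => p + s • z := by fun_prop
  have i1 : ∀ e, Integrable fun z =>
      fderiv ℝ v (p + s • z) e * (fderiv ℝ cylNormSq z e * cylKernel z) := fun e =>
    ((((hv.continuous_fderiv (by norm_num)).comp hlin).clm_apply continuous_const).mul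
      ((hqc e).mul continuous_cylKernel)).integrable_of_hasCompactSupport
        hasCompactSupport_cylKernel.mul_left.mul_left
  have i2 : ∀ e, Integrable fun z => secondDirDeriv v e (p + s • z) * cylKernel z ^ 2 := by
    intro e
    exact (((hv.continuous_secondDirDeriv e).comp hlin).mul
      (continuous_cylKernel.pow 2)).integrable_of_hasCompactSupport hgs.mul_left
  have e1 : ∀ z, fderiv ℝ v (p + s • z) z * cylKernel z =
      1 / 2 * (fderiv ℝ v (p + s • z) (1, 0) * (fderiv ℝ cylNormSq z (1, 0) * cylKernel z) +
        ∑ i, fderiv ℝ v (p + s • z) (0, Pi.single i 1) *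
          (fderiv ℝ cylNormSq z (0, Pi.single i 1) * cylKernel z)) := by
    intro z
    rw [fderiv_apply_eq_sum]
    simp only [fderiv_cylNormSq_fst, fderiv_cylNormSq_single, Fin.sum_univ_three]
    ring
  have e2 : ∀ z, frechetLaplacian v (p + s • z) * cylKernel z ^ 2 =
      secondDirDeriv v (1, 0) (p + s • z) * cylKernel z ^ 2 +
        ∑ i, secondDirDeriv v (0, Pi.single i 1) (p + s • z) * cylKernel z ^ 2 := by
    intro z
    rw [frechetLaplacian, add_mul, Finset.sum_mul]
  simp only [e1, e2]
  rw [integral_const_mul, integral_add (i1 _) (integrable_finsetSum _ fun i _ => i1 _),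
    integral_add (i2 _) (integrable_finsetSum _ fun i _ => i2 _),
    integral_finsetSum _ fun i _ => i1 _, integral_finsetSum _ fun i _ => i2 _]
  simp only [integral_fderiv_mul_fderiv_cylNormSq_mul_cylKernel p s hv, Fin.sum_univ_three]
  ring

/-- A weighted sub-mean value inequality for functions with Laplacian bounded from below. -/
lemma ContDiff.mul_integral_cylKernel_le (hv : ContDiff ℝ 2 v) {r C : ℝ} (hr : 0 ≤ r)
    (hC : 0 ≤ C)
    (hlap : ∀ s ∈ Set.Icc 0 r, ∀ z, cylNormSq z ≤ 1 → -C ≤ frechetLaplacian v (p + s • z)) :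
    v p * ∫ z, cylKernel z ≤
      (∫ z, v (p + r • z) * cylKernel z) + r ^ 2 / 8 * C * ∫ z, cylKernel z := by
  set κ := ∫ z, cylKernel z with hκ
  have hgs := hasCompactSupport_cylKernel_sq
  have hd : ∀ s, HasDerivAt (fun s => (∫ z, v (p + s • z) * cylKernel z) + s ^ 2 / 8 * C * κ)
      ((∫ z, fderiv ℝ v (p + s • z) z * cylKernel z) + s / 4 * C * κ) s := by
    intro s
    have h := ((((hasDerivAt_pow 2 s).div_const 8).mul_const C).mul_const κ)
    have e : ((2 : ℕ) : ℝ) * s ^ (2 - 1) / 8 * C * κ = s / 4 * C * κ := by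
      rw [show 2 - 1 = 1 from rfl, pow_one]
      push_cast
      ring
    rw [e] at h
    exact (hasDerivAt_integral_mul_cylKernel p s hv).add h
  have hmono : MonotoneOn (fun s => (∫ z, v (p + s • z) * cylKernel z) + s ^ 2 / 8 * C * κ)
      (Set.Icc 0 r) := by
    refine monotoneOn_of_deriv_nonneg (convex_Icc 0 r)
      (fun s _ => (hd s).continuousAt.continuousWithinAt)
      (fun s _ => (hd s).differentiableAt.differentiableWithinAt) fun s hs => ?_
    have hs' := interior_subset hs
    rw [(hd s).deriv, integral_fderiv_mul_cylKernel p s hv]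
    have hle : -C * κ ≤ ∫ z, frechetLaplacian v (p + s • z) * cylKernel z ^ 2 := by
      rw [hκ, ← integral_const_mul]
      refine integral_mono (integrable_cylKernel.const_mul (-C))
        (((hv.continuous_frechetLaplacian.comp (by fun_prop)).mul
          (continuous_cylKernel.pow 2)).integrable_of_hasCompactSupport hgs.mul_left) fun z => ?_
      rcases le_or_gt (cylNormSq z) 1 with hz | hz
      · have h1 := hlap s hs' z hz
        have h2 := cylKernel_nonneg z
        have h3 := cylKernel_le_one z
        have h4 : cylKernel z ^ 2 ≤ cylKernel z := by nlinarith
        calc -C * cylKernel z ≤ -C * cylKernel z ^ 2 := by nlinarith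
          _ ≤ frechetLaplacian v (p + s • z) * cylKernel z ^ 2 := by gcongr
      · simp [cylKernel_eq_zero hz.le]
    have : 0 ≤ s := hs'.1
    nlinarith
  have h := hmono (Set.left_mem_Icc.mpr hr) (Set.right_mem_Icc.mpr hr) hr
  simp only [zero_smul, add_zero] at h
  rw [integral_const_mul] at h
  simpa using h

end MeanValue

lemma exists_contDiff_eq_of_lt_fst {v : ℝ × (Fin 3 → ℝ) → ℝ} {c c' : ℝ} (hc : c < c')
    (hv : ∀ x : ℝ × (Fin 3 → ℝ), c < x.1 → ContDiffAt ℝ 2 v x) :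
    ∃ V : ℝ × (Fin 3 → ℝ) → ℝ, ContDiff ℝ 2 V ∧ ∀ x, c' < x.1 → V x = v x := by
  set c₀ := (c + c') / 2 with hc₀
  have hc0 : c < c₀ := by rw [hc₀]; linarith
  have hc1 : c₀ < c' := by rw [hc₀]; linarith
  have hpos : 0 < c' - c₀ := sub_pos.mpr hc1
  refine ⟨fun x => Real.smoothTransition ((x.1 - c₀) / (c' - c₀)) * v x, ?_, fun x hx => ?_⟩
  · rw [contDiff_iff_contDiffAt]
    intro x
    rcases lt_or_ge c x.1 with hx | hx
    · refine ContDiffAt.mul ?_ (hv x hx)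
      exact ((Real.smoothTransition.contDiff (n := 2)).comp
        ((contDiff_fst.sub contDiff_const).div_const _)).contDiffAt
    · refine (contDiffAt_const (c := (0 : ℝ))).congr_of_eventuallyEq ?_
      filter_upwards [continuous_fst.continuousAt.preimage_mem_nhds
        (Iio_mem_nhds (hx.trans_lt hc0))] with y hy
      have hy' : y.1 < c₀ := hy
      rw [Real.smoothTransition.zero_of_nonpos
        (div_nonpos_of_nonpos_of_nonneg (by linarith) hpos.le), zero_mul]
  · show Real.smoothTransition ((x.1 - c₀) / (c' - c₀)) * v x = v x
    rw [Real.smoothTransition.one_of_one_le, one_mul]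
    rw [le_div_iff₀ hpos]
    linarith

/-- One step of the iteration: passing to the average over a ball of radius
`3/8 · w^{-1/3}`, on most of which `v` vanishes. -/
lemma le_quarter_mul_add {ζ : ℝ → ℝ} (hζ : IsCutoff ζ) {a : ℕ → Fin 3 → ℤ} (ha : IsGoodSeq a)
    {v : ℝ × (Fin 3 → ℝ) → ℝ}
    (hv : ∀ x : ℝ × (Fin 3 → ℝ), wseq 2 < x.1 → ContDiffAt ℝ 2 v x)
    (hvf : ∀ x : ℝ × (Fin 3 → ℝ), wseq 2 < x.1 → 0 < v x → |f0 ζ a x.1 x.2| < 2 * hSmall)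
    {p : ℝ × (Fin 3 → ℝ)} {r S C : ℝ} (hr : r = 3 / 8 * p.1 ^ (-(1 : ℝ) / 3))
    (hp : wseq 2 < p.1 - r) (hp' : 4 / 5 * p.1 ≤ p.1 - r) (hp0 : 0 < p.1) (hS : 0 ≤ S) (hC : 0 ≤ C)
    (hlap : ∀ x : ℝ × (Fin 3 → ℝ), p.1 - r ≤ x.1 → -C ≤ frechetLaplacian v x)
    (hvS : ∀ x : ℝ × (Fin 3 → ℝ), p.1 - r ≤ x.1 → v x ≤ S) :
    v p ≤ 1 / 4 * S + r ^ 2 / 8 * C := by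
  have hr0 : 0 < r := by rw [hr]; positivity
  obtain ⟨c', hc, hc'⟩ := exists_between hp
  obtain ⟨V, hV, hVv⟩ := exists_contDiff_eq_of_lt_fst hc hv
  have hball : ∀ s ∈ Set.Icc 0 r, ∀ z : ℝ × (Fin 3 → ℝ), -1 ≤ z.1 →
      p.1 - r ≤ (p + s • z).1 := by
    intro s hs z hz
    simp only [Prod.fst_add, Prod.smul_fst, smul_eq_mul]
    nlinarith [hs.1, hs.2]
  have hVlap : ∀ x : ℝ × (Fin 3 → ℝ), p.1 - r ≤ x.1 → -C ≤ frechetLaplacian V x := by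
    intro x hx
    have : V =ᶠ[nhds x] v := by
      filter_upwards [continuous_fst.continuousAt.preimage_mem_nhds
        (Ioi_mem_nhds (hc'.trans_le hx))] with y hy using hVv y hy
    rw [this.frechetLaplacian_eq]
    exact hlap x hx
  have key := hV.mul_integral_cylKernel_le p hr0.le hC fun s hs z hz =>
    hVlap _ (hball s hs z (mem_Icc_of_cylNormSq_le_one hz).1.1)
  rw [hVv p (by linarith)] at key
  set κ := ∫ z, cylKernel z with hκ
  have hκ1 := le_integral_cylKernel
  rw [← hκ] at hκ1
  set E : Set (ℝ × (Fin 3 → ℝ)) := {z | 0 < V (p + r • z)} ∩ Set.Icc (-1) 1 with hE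
  have hVc : Continuous fun z => V (p + r • z) := hV.continuous.comp (by fun_prop)
  have hEm : MeasurableSet E :=
    (isOpen_lt continuous_const hVc).measurableSet.inter measurableSet_Icc
  have hvol : volume E ≤ 2 * (27 * ENNReal.ofReal (2 / 345)) := by
    refine volume_le_of_forall_slice hEm (fun z hz => ⟨hz.2.1.1, hz.2.2.1⟩) fun t ht => ?_
    have ht' : p.1 - r ≤ p.1 + r * t := by nlinarith [ht.1]
    refine volume_slice_le hζ ha hp0 (hp.le.trans ht') (hp'.trans ht') p.2
      (measurable_prodMk_left hEm) (fun z hz => ⟨hz.2.1.2, hz.2.2.2⟩) fun z hz => ?_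
    rw [← hr]
    have h1 : 0 < V (p + r • (t, z)) := hz.1
    rw [hVv _ (hc'.trans_le (hball r ⟨hr0.le, le_rfl⟩ (t, z) ht.1))] at h1
    exact hvf _ (hp.trans_le (hball r ⟨hr0.le, le_rfl⟩ (t, z) ht.1)) h1
  have hvol' : volume.real E ≤ 108 / 345 := by
    refine ENNReal.toReal_le_of_le_ofReal (by norm_num) (hvol.trans_eq ?_)
    rw [← ENNReal.ofReal_ofNat 27, ← ENNReal.ofReal_ofNat 2, ← ENNReal.ofReal_mul (by norm_num),
      ← ENNReal.ofReal_mul (by norm_num)]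
    norm_num
  have hint : ∫ z, V (p + r • z) * cylKernel z ≤ S * volume.real E := by
    have hfin : volume E ≠ ⊤ := ne_top_of_le_ne_top
      (isCompact_Icc (a := (-1 : ℝ × (Fin 3 → ℝ))) (b := 1)).measure_ne_top
      (measure_mono Set.inter_subset_right)
    have h1 : ∫ z, E.indicator (fun _ => S) z = S * volume.real E := by
      rw [integral_indicator_const _ hEm, smul_eq_mul, mul_comm]
    rw [← h1]
    refine integral_mono
      ((hVc.mul continuous_cylKernel).integrable_of_hasCompactSupport
        hasCompactSupport_cylKernel.mul_left)
      ((integrable_indicator_iff hEm).mpr (integrableOn_const hfin)) fun z => ?_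
    show V (p + r • z) * cylKernel z ≤ E.indicator (fun _ => S) z
    by_cases hz : z ∈ E
    · rw [Set.indicator_of_mem hz]
      have h2 := hball r ⟨hr0.le, le_rfl⟩ z hz.2.1.1
      have h3 : V (p + r • z) ≤ S := by
        rw [hVv _ (hc'.trans_le h2)]
        exact hvS _ h2
      have h4 : 0 < V (p + r • z) := hz.1
      nlinarith [cylKernel_nonneg z, cylKernel_le_one z]
    · rw [Set.indicator_of_notMem hz]
      rcases le_or_gt 1 (cylNormSq z) with h2 | h2
      · rw [cylKernel_eq_zero h2, mul_zero]
      · refine mul_nonpos_of_nonpos_of_nonneg ?_ (cylKernel_nonneg z)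
        by_contra! h3
        exact hz ⟨h3, mem_Icc_of_cylNormSq_le_one h2.le⟩
  have hfinal : v p * κ ≤ (1 / 4 * S + r ^ 2 / 8 * C) * κ := by
    nlinarith

  exact le_of_mul_le_mul_right hfinal (by linarith)

lemma rpow_four_thirds_sub_half_le {w r : ℝ} (hw : 0 < w) (hr : r = 3 / 8 * w ^ (-(1 : ℝ) / 3))
    (hrw : r ≤ w) : w ^ ((4 : ℝ) / 3) - 1 / 2 ≤ (w - r) ^ ((4 : ℝ) / 3) := by
  have h1 := one_add_mul_self_le_rpow_one_add (s := -(r / w))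
    (by rw [neg_le_neg_iff]; exact (div_le_one hw).mpr hrw) (p := (4 : ℝ) / 3) (by norm_num)
  have h2 : w - r = w * (1 + -(r / w)) := by field_simp; ring
  have h3 : 0 ≤ 1 + -(r / w) := by
    have := (div_le_one hw).mpr hrw
    linarith
  have h4 : r / w * w ^ ((4 : ℝ) / 3) = 3 / 8 := by
    have e1 : w ^ (-(1 : ℝ) / 3) * w ^ ((4 : ℝ) / 3) = w := by
      rw [← Real.rpow_add hw]
      norm_num
    rw [hr, div_mul_eq_mul_div, mul_assoc, e1, mul_div_assoc, div_self hw.ne', mul_one]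
  rw [h2, Real.mul_rpow hw.le h3]
  calc w ^ ((4 : ℝ) / 3) - 1 / 2 = w ^ ((4 : ℝ) / 3) * (1 + 4 / 3 * -(r / w)) := by
        linear_combination (4 / 3 : ℝ) * h4
    _ ≤ _ := by gcongr

lemma wseq_two_pos : 0 < wseq 2 := by
  unfold wseq
  positivity

lemma exp_half_le : Real.exp (1 / 2) ≤ 5 / 3 := by
  have h1 : Real.exp (1 / 2) ^ 2 = Real.exp 1 := by
    rw [← Real.exp_nat_mul]
    norm_num
  have h2 := Real.exp_one_lt_d9
  have h3 := Real.exp_pos (1 / 2)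
  nlinarith

/-- The bound obtained after `n` steps of the iteration. -/
lemma le_decay_add_geometric {ζ : ℝ → ℝ} (hζ : IsCutoff ζ) {a : ℕ → Fin 3 → ℤ} (ha : IsGoodSeq a)
    {v : ℝ × (Fin 3 → ℝ) → ℝ} {C M A : ℝ} (hC : 0 < C) (hM : 0 < M) (hA : 3 / 4 * C ≤ A)
    (hv : ∀ x : ℝ × (Fin 3 → ℝ), wseq 2 < x.1 → ContDiffAt ℝ 2 v x)
    (hvf : ∀ x : ℝ × (Fin 3 → ℝ), wseq 2 < x.1 → 0 < v x → |f0 ζ a x.1 x.2| < 2 * hSmall)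
    (hvM : ∀ x, v x ≤ M)
    (hlap : ∀ x : ℝ × (Fin 3 → ℝ), wseq 2 < x.1 →
      -(C * Real.exp (-(x.1 ^ ((4 : ℝ) / 3)))) ≤ frechetLaplacian v x)
    (n : ℕ) {p : ℝ × (Fin 3 → ℝ)} (hp0 : 0 < p.1)
    (hp : 81 / 4 + (n : ℝ) / 2 < p.1 ^ ((4 : ℝ) / 3)) :
    v p ≤ A * p.1 ^ (-(2 : ℝ) / 3) * Real.exp (-(p.1 ^ ((4 : ℝ) / 3))) + M * (1 / 4) ^ n := by
  have hA0 : 0 < A := by linarith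
  induction n generalizing p with
  | zero =>
    have : 0 ≤ A * p.1 ^ (-(2 : ℝ) / 3) * Real.exp (-(p.1 ^ ((4 : ℝ) / 3))) := by positivity
    have := hvM p
    simp only [pow_zero, mul_one]
    linarith
  | succ n ih =>
    push_cast at hp
    obtain ⟨w, y⟩ := p
    simp only at hp hp0 ⊢
    obtain ⟨r, hr⟩ : ∃ r, r = 3 / 8 * w ^ (-(1 : ℝ) / 3) := ⟨_, rfl⟩
    set W := w ^ ((4 : ℝ) / 3) with hW
    set D := w ^ (-(2 : ℝ) / 3) with hD
    have hD0 : 0 < D := by positivity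
    have hn : (0 : ℝ) ≤ n := n.cast_nonneg
    have hr0 : 0 < r := by rw [hr]; positivity
    have hrw : r ≤ w / 5 := by
      have e1 : w ^ (-(1 : ℝ) / 3) * W = w := by
        rw [hW, ← Real.rpow_add hp0]
        norm_num
      rw [hr]
      nlinarith [Real.rpow_pos_of_pos hp0 (-(1 : ℝ) / 3)]
    have hwr : 0 < w - r := by linarith
    have hWr : W - 1 / 2 ≤ (w - r) ^ ((4 : ℝ) / 3) :=
      rpow_four_thirds_sub_half_le hp0 hr (by linarith)
    have hw2 : wseq 2 < w - r := by
      have h2 := wseq_rpow_four_thirds 2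
      norm_num at h2
      refine (Real.rpow_lt_rpow_iff wseq_two_pos.le hwr.le (z := (4 : ℝ) / 3) (by norm_num)).mp ?_
      rw [h2]
      linarith
    have hmono : ∀ t, w - r ≤ t → (w - r) ^ ((4 : ℝ) / 3) ≤ t ^ ((4 : ℝ) / 3) := fun t ht =>
      Real.rpow_le_rpow hwr.le ht (by norm_num)
    have hexp : ∀ t, w - r ≤ t → Real.exp (-(t ^ ((4 : ℝ) / 3))) ≤ 5 / 3 * Real.exp (-W) := by
      intro t ht
      calc Real.exp (-(t ^ ((4 : ℝ) / 3))) ≤ Real.exp (1 / 2 + -W) := by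
            apply Real.exp_le_exp.mpr
            linarith [hmono t ht]
        _ = Real.exp (1 / 2) * Real.exp (-W) := Real.exp_add _ _
        _ ≤ _ := by gcongr; exact exp_half_le
    have hdec : ∀ t, w - r ≤ t → t ^ (-(2 : ℝ) / 3) ≤ 5 / 4 * D := by
      intro t ht
      have h1 : t ^ (-(2 : ℝ) / 3) ≤ (4 / 5 * w) ^ (-(2 : ℝ) / 3) :=
        Real.rpow_le_rpow_of_nonpos (by positivity) (by linarith) (by norm_num)
      have h2 : (4 / 5 : ℝ) ^ (-(2 : ℝ) / 3) ≤ 5 / 4 := by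
        calc (4 / 5 : ℝ) ^ (-(2 : ℝ) / 3) ≤ (4 / 5 : ℝ) ^ (-1 : ℝ) :=
              Real.rpow_le_rpow_of_exponent_ge (by norm_num) (by norm_num) (by norm_num)
          _ = 5 / 4 := by rw [Real.rpow_neg_one]; norm_num
      rw [Real.mul_rpow (by norm_num) hp0.le] at h1
      exact h1.trans (by gcongr)
    have hr2 : r ^ 2 = 9 / 64 * D := by
      have : (w ^ (-(1 : ℝ) / 3)) ^ 2 = D := by
        rw [← Real.rpow_natCast, ← Real.rpow_mul hp0.le, hD]
        norm_num
      rw [hr, mul_pow, this]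
      norm_num
    have key := le_quarter_mul_add hζ ha hv hvf (p := (w, y)) (r := r)
      (S := A * (5 / 4 * D) * (5 / 3 * Real.exp (-W)) + M * (1 / 4) ^ n)
      (C := C * (5 / 3 * Real.exp (-W))) hr hw2 (by simp only; linarith) hp0 (by positivity)
      (by positivity) (fun x hx => ?_) (fun x hx => ?_)
    · rw [hr2] at key
      have h1 : (1 / 4 * (5 / 4) * (5 / 3) * A + 9 / 64 / 8 * (5 / 3) * C) * (D * Real.exp (-W)) ≤
          A * (D * Real.exp (-W)) := by
        gcongr
        linarith
      rw [pow_succ]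
      linarith
    · refine le_trans ?_ (hlap x (hw2.trans_le hx))
      rw [neg_le_neg_iff]
      gcongr
      exact hexp _ hx
    · refine (ih (hwr.trans_le hx) ?_).trans ?_
      · have := hmono _ hx
        linarith
      · gcongr
        · exact hdec _ hx
        · exact hexp _ hx

lemma le_decay_add_exp {ζ : ℝ → ℝ} (hζ : IsCutoff ζ) {a : ℕ → Fin 3 → ℤ} (ha : IsGoodSeq a)
    {v : ℝ × (Fin 3 → ℝ) → ℝ} {C M A : ℝ} (hC : 0 < C) (hM : 0 < M) (hA : 3 / 4 * C ≤ A)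
    (hv : ∀ x : ℝ × (Fin 3 → ℝ), wseq 2 < x.1 → ContDiffAt ℝ 2 v x)
    (hvf : ∀ x : ℝ × (Fin 3 → ℝ), wseq 2 < x.1 → 0 < v x → |f0 ζ a x.1 x.2| < 2 * hSmall)
    (hvM : ∀ x, v x ≤ M)
    (hlap : ∀ x : ℝ × (Fin 3 → ℝ), wseq 2 < x.1 →
      -(C * Real.exp (-(x.1 ^ ((4 : ℝ) / 3)))) ≤ frechetLaplacian v x)
    {p : ℝ × (Fin 3 → ℝ)} (hp : wseq 6 ≤ p.1) :
    v p ≤ A * p.1 ^ (-(2 : ℝ) / 3) * Real.exp (-(p.1 ^ ((4 : ℝ) / 3))) +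
      Real.exp 1 ^ 4 * M * Real.exp (-2 * p.1 ^ ((4 : ℝ) / 3)) := by
  have h6 : 0 < wseq 6 := by unfold wseq; positivity
  have hp0 := h6.trans_le hp
  set W := p.1 ^ ((4 : ℝ) / 3) with hW
  have hW6 : 729 / 4 ≤ W := by
    have h := wseq_rpow_four_thirds 6
    norm_num at h
    rw [← h]
    exact Real.rpow_le_rpow h6.le hp (by norm_num)
  obtain ⟨n, hn⟩ : ∃ n : ℕ, ⌈2 * (W - 81 / 4)⌉₊ = n + 1 :=
    Nat.exists_eq_succ_of_ne_zero (Nat.ceil_pos.mpr (by linarith)).ne'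
  have h1 : 2 * (W - 81 / 4) ≤ n + 1 := by
    have := Nat.le_ceil (2 * (W - 81 / 4))
    rw [hn] at this
    exact_mod_cast this
  have h2 : (n : ℝ) < 2 * (W - 81 / 4) := by
    have : n < ⌈2 * (W - 81 / 4)⌉₊ := by omega
    exact Nat.lt_ceil.mp this
  refine (le_decay_add_geometric hζ ha hC hM hA hv hvf hvM hlap n hp0
    (by rw [← hW]; linarith)).trans ?_
  have h3 : (1 / 4 : ℝ) ≤ Real.exp (-(5 / 4)) := by
    have e1 : Real.exp (5 / 4) ^ 4 = Real.exp 1 ^ 5 := by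
      rw [← Real.exp_nat_mul, ← Real.exp_nat_mul]
      norm_num
    have e2 : Real.exp (5 / 4) ≤ 4 := by
      refine le_of_pow_le_pow_left₀ (n := 4) (by norm_num) (by norm_num) ?_
      rw [e1]
      calc Real.exp 1 ^ 5 ≤ (2.72 : ℝ) ^ 5 := by
            gcongr
            linarith [Real.exp_one_lt_d9]
        _ ≤ 4 ^ 4 := by norm_num
    rw [Real.exp_neg, ← one_div]
    exact one_div_le_one_div_of_le (Real.exp_pos _) e2
  have h4 : (1 / 4 : ℝ) ^ n ≤ Real.exp 1 ^ 4 * Real.exp (-2 * W) := by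
    calc (1 / 4 : ℝ) ^ n ≤ Real.exp (-(5 / 4)) ^ n := by gcongr
      _ = Real.exp (n * -(5 / 4)) := (Real.exp_nat_mul _ _).symm
      _ ≤ Real.exp ((4 : ℕ) * 1 + -2 * W) := by
        apply Real.exp_le_exp.mpr
        push_cast
        linarith
      _ = _ := by rw [Real.exp_add, Real.exp_nat_mul]
  have h5 : M * (1 / 4) ^ n ≤ Real.exp 1 ^ 4 * M * Real.exp (-2 * W) := by
    calc M * (1 / 4) ^ n ≤ M * (Real.exp 1 ^ 4 * Real.exp (-2 * W)) := by gcongr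
      _ = _ := by ring

  linarith

/-- A `C²` approximation of the positive part, vanishing on `(-∞, ε]`. -/
def softPos (ε t : ℝ) : ℝ := ∫ s in (0 : ℝ)..t, Real.smoothTransition ((s - ε) / ε)

section SoftPos

variable {ε : ℝ}

lemma contDiff_smoothTransition_sub_div {n : ℕ∞} :
    ContDiff ℝ n fun s => Real.smoothTransition ((s - ε) / ε) :=
  Real.smoothTransition.contDiff.comp ((contDiff_id.sub contDiff_const).div_const _)

lemma hasDerivAt_softPos (t : ℝ) :
    HasDerivAt (softPos ε) (Real.smoothTransition ((t - ε) / ε)) t :=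
  (contDiff_smoothTransition_sub_div (n := 0)).continuous.integral_hasStrictDerivAt 0 t
    |>.hasDerivAt

lemma contDiff_softPos : ContDiff ℝ 2 (softPos ε) := by
  have hd : deriv (softPos ε) = fun t => Real.smoothTransition ((t - ε) / ε) :=
    funext fun t => (hasDerivAt_softPos t).deriv
  rw [show (2 : WithTop ℕ∞) = 1 + 1 by norm_num, contDiff_succ_iff_deriv, hd]
  exact ⟨fun t => (hasDerivAt_softPos t).differentiableAt, by simp,
    contDiff_smoothTransition_sub_div (n := 1)⟩

lemma softPos_eq_zero (hε : 0 < ε) {t : ℝ} (ht : t ≤ ε) : softPos ε t = 0 := by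
  unfold softPos
  rw [intervalIntegral.integral_congr (g := fun _ => (0 : ℝ)), intervalIntegral.integral_zero]
  intro s hs
  have h1 : s ≤ max 0 t := hs.2
  have h2 : s ≤ ε := h1.trans (max_le hε.le ht)
  exact Real.smoothTransition.zero_of_nonpos
    (div_nonpos_of_nonpos_of_nonneg (by linarith) hε.le)

lemma softPos_le {t : ℝ} (ht : 0 ≤ t) : softPos ε t ≤ t := by
  calc softPos ε t ≤ ∫ _ in (0 : ℝ)..t, (1 : ℝ) := by
        refine intervalIntegral.integral_mono_on ht
          ((contDiff_smoothTransition_sub_div (n := 0)).continuous.intervalIntegrable _ _)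
          intervalIntegrable_const fun s _ => Real.smoothTransition.le_one _
    _ = t := by simp

lemma softPos_nonneg {t : ℝ} (ht : 0 ≤ t) : 0 ≤ softPos ε t :=
  intervalIntegral.integral_nonneg ht fun _ _ => Real.smoothTransition.nonneg _

lemma le_softPos_add (hε : 0 < ε) {t : ℝ} (ht : 0 ≤ t) : t ≤ softPos ε t + 2 * ε := by
  rcases le_or_gt t (2 * ε) with h | h
  · linarith [softPos_nonneg (ε := ε) ht]
  have hi : ∀ a b, IntervalIntegrable (fun s => Real.smoothTransition ((s - ε) / ε)) volume a b :=
    (contDiff_smoothTransition_sub_div (n := 0)).continuous.intervalIntegrable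
  have h1 : softPos ε t =
      softPos ε (2 * ε) + ∫ s in (2 * ε)..t, Real.smoothTransition ((s - ε) / ε) :=
    (intervalIntegral.integral_add_adjacent_intervals (hi _ _) (hi _ _)).symm
  have h2 : ∫ s in (2 * ε)..t, Real.smoothTransition ((s - ε) / ε) = t - 2 * ε := by
    rw [intervalIntegral.integral_congr (g := fun _ => (1 : ℝ))]
    · simp
    · intro s hs
      rw [Set.uIcc_of_le h.le] at hs
      refine Real.smoothTransition.one_of_one_le ?_
      rw [le_div_iff₀ hε]
      linarith [hs.1]
  have h3 := softPos_nonneg (ε := ε) (t := 2 * ε) (by linarith)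
  linarith

end SoftPos

lemma secondDirDeriv_eq_deriv_deriv {v : ℝ × (Fin 3 → ℝ) → ℝ} {x e : ℝ × (Fin 3 → ℝ)}
    (hv : ContDiffAt ℝ 2 v x) {γ : ℝ → ℝ × (Fin 3 → ℝ)} {t : ℝ}
    (hγ : ∀ s, γ s = x + (s - t) • e) :
    deriv (deriv fun s => v (γ s)) t = secondDirDeriv v e x := by
  have hγx : γ t = x := by simp [hγ]
  have hγd : ∀ s, HasDerivAt γ e s := fun s => by
    rw [funext hγ]
    simpa using (((hasDerivAt_id s).sub_const t).smul_const e).const_add x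
  have h1 : (deriv fun s => v (γ s)) =ᶠ[nhds t] fun s => fderiv ℝ v (γ s) e := by
    have hev : ∀ᶠ y in nhds (γ t), ContDiffAt ℝ 2 v y := by
      rw [hγx]
      exact hv.eventually (by simp)
    filter_upwards [(hγd t).continuousAt.eventually hev] with s hs
    exact ((hs.differentiableAt (by norm_num)).hasFDerivAt.comp_hasDerivAt s (hγd s)).deriv
  rw [h1.deriv_eq]
  have h2 : DifferentiableAt ℝ (fun y => fderiv ℝ v y e) (γ t) := by
    rw [hγx]
    exact ((hv.fderiv_right (m := 1) (by norm_num)).differentiableAt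
      (by norm_num)).clm_apply (differentiableAt_const _)
  refine (h2.hasFDerivAt.comp_hasDerivAt t (hγd t)).deriv.trans ?_
  rw [hγx, secondDirDeriv]

lemma cylLaplacian3_eq_frechetLaplacian {v : ℝ × (Fin 3 → ℝ) → ℝ} {x : ℝ × (Fin 3 → ℝ)}
    (hv : ContDiffAt ℝ 2 v x) : cylLaplacian3 v x = frechetLaplacian v x := by
  unfold cylLaplacian3 frechetLaplacian
  congr 1
  · refine secondDirDeriv_eq_deriv_deriv hv fun s => ?_
    ext i <;> simp
  · refine Finset.sum_congr rfl fun i _ => secondDirDeriv_eq_deriv_deriv hv fun s => ?_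
    ext j
    · simp
    · by_cases h : j = i
      · subst h
        simp
      · simp [h]

lemma secondDirDeriv_softPos_comp {ε : ℝ} {v : ℝ × (Fin 3 → ℝ) → ℝ} {x : ℝ × (Fin 3 → ℝ)}
    (hv : ContDiffAt ℝ 2 v x) (hε : 0 < ε) (e : ℝ × (Fin 3 → ℝ)) :
    Real.smoothTransition ((v x - ε) / ε) * secondDirDeriv v e x ≤
      secondDirDeriv (fun y => softPos ε (v y)) e x := by
  set g : ℝ → ℝ := fun s => Real.smoothTransition ((s - ε) / ε) with hg
  have hgd : Differentiable ℝ g :=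
    (contDiff_smoothTransition_sub_div (n := 1)).differentiable (by norm_num)
  have hgm : Monotone g := fun s t hst =>
    Real.smoothTransition.monotone (by gcongr)
  have h1 : (fun y => fderiv ℝ (fun y => softPos ε (v y)) y e) =ᶠ[nhds x]
      fun y => g (v y) * fderiv ℝ v y e := by
    filter_upwards [hv.eventually (by simp)] with y hy
    have := (hasDerivAt_softPos (ε := ε) (v y)).comp_hasFDerivAt y
      (hy.differentiableAt (by norm_num)).hasFDerivAt
    have h2 := this.fderiv
    simp only [Function.comp_def] at h2
    rw [h2]
    rfl
  have h2 : DifferentiableAt ℝ (fun y => fderiv ℝ v y e) x :=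
    ((hv.fderiv_right (m := 1) (by norm_num)).differentiableAt
      (by norm_num)).clm_apply (differentiableAt_const _)
  have h3 := (hgd (v x)).hasDerivAt.comp_hasFDerivAt x
    (hv.differentiableAt (by norm_num)).hasFDerivAt
  have h4 := (h3.mul h2.hasFDerivAt).fderiv
  have h5 : secondDirDeriv (fun y => softPos ε (v y)) e x =
      g (v x) * secondDirDeriv v e x + deriv g (v x) * fderiv ℝ v x e ^ 2 := by
    unfold secondDirDeriv
    rw [h1.fderiv_eq]
    refine (congrArg (fun L => L e) h4).trans ?_
    simp
    ring
  rw [h5]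
  have := hgm.deriv_nonneg (x := v x)
  have : 0 ≤ deriv g (v x) * fderiv ℝ v x e ^ 2 := by positivity
  linarith

lemma smoothTransition_mul_frechetLaplacian_le {ε : ℝ} {v : ℝ × (Fin 3 → ℝ) → ℝ}
    {x : ℝ × (Fin 3 → ℝ)} (hv : ContDiffAt ℝ 2 v x) (hε : 0 < ε) :
    Real.smoothTransition ((v x - ε) / ε) * frechetLaplacian v x ≤
      frechetLaplacian (fun y => softPos ε (v y)) x := by
  unfold frechetLaplacian
  rw [mul_add, Finset.mul_sum]
  exact add_le_add (secondDirDeriv_softPos_comp hv hε _)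

    (Finset.sum_le_sum fun i _ => secondDirDeriv_softPos_comp hv hε _)

lemma contDiffAt_softPos_and_le_frechetLaplacian {Ω U : Set (ℝ × (Fin 3 → ℝ))}
    {u : ℝ × (Fin 3 → ℝ) → ℝ} {v : ℝ × (Fin 3 → ℝ) → ℝ} {x : ℝ × (Fin 3 → ℝ)} {ε c : ℝ}
    (hε : 0 < ε) (hc : 0 ≤ c) (hU : IsOpen U) (hu : ContDiffOn ℝ 2 u U)
    (hxU : x ∈ closure Ω → x ∈ U) (hu0 : ∀ y ∈ frontier Ω, u y = 0)
    (hv : ∀ y ∈ closure Ω, v y = softPos ε (u y)) (hv0 : ∀ y ∉ closure Ω, v y = 0)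
    (hlap : x ∈ Ω → -c ≤ cylLaplacian3 u x) :
    ContDiffAt ℝ 2 v x ∧ -c ≤ frechetLaplacian v x := by
  have hzero : v =ᶠ[nhds x] (fun _ => 0) → ContDiffAt ℝ 2 v x ∧ -c ≤ frechetLaplacian v x := by
    intro h
    refine ⟨contDiffAt_const.congr_of_eventuallyEq h, ?_⟩
    rw [h.frechetLaplacian_eq]
    simpa [frechetLaplacian, secondDirDeriv] using hc
  by_cases hx : x ∈ closure Ω
  · have hux : ContDiffAt ℝ 2 u x := hu.contDiffAt (hU.mem_nhds (hxU hx))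
    rcases lt_or_ge (u x) ε with h | h
    · refine hzero ?_
      filter_upwards [hux.continuousAt.preimage_mem_nhds (Iio_mem_nhds h)] with y hy
      by_cases hyΩ : y ∈ closure Ω
      · rw [hv y hyΩ, softPos_eq_zero hε (le_of_lt hy)]
      · exact hv0 y hyΩ
    · have hxi : x ∈ interior Ω := by
        by_contra hxi
        have := hu0 x ⟨hx, hxi⟩
        linarith
      have hev : v =ᶠ[nhds x] fun y => softPos ε (u y) := by
        filter_upwards [isOpen_interior.mem_nhds hxi] with y hy
        exact hv y (subset_closure (interior_subset hy))
      refine ⟨(contDiff_softPos.contDiffAt.comp x hux).congr_of_eventuallyEq hev, ?_⟩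
      rw [hev.frechetLaplacian_eq]
      refine le_trans ?_ (smoothTransition_mul_frechetLaplacian_le hux hε)
      have h1 := hlap (interior_subset hxi)
      rw [cylLaplacian3_eq_frechetLaplacian hux] at h1
      have h2 := Real.smoothTransition.nonneg ((u x - ε) / ε)
      have h3 := Real.smoothTransition.le_one ((u x - ε) / ε)
      nlinarith
  · refine hzero ?_
    filter_upwards [isClosed_closure.isOpen_compl.mem_nhds hx] with y hy using hv0 y hy

/-- **Iterated bound of §5.** Let `C̃, M > 0`, let `φ` be continuous on `Ω` with
`0 ≤ φ(w,y) ≤ C̃e^{-w^{4/3}}` on `Ω`, and let `u` satisfy `0 ≤ u ≤ M` on `cl(Ω)`,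
`u = 0` on `∂Ω`, `u` is `C²` on a neighborhood of `cl(Ω) ∩ {w > w₂}`, and `-Δu = φ`
on `Ω ∩ {w > w₂}`. Then for all `(w,y) ∈ Ω` with `w ≥ w₆`:
`u(w,y) ≤ (9e/32)·C̃·w^{-2/3}·e^{-w^{4/3}} + e⁴·M·e^{-2w^{4/3}}`. -/
theorem statement17 (ζ : ℝ → ℝ) (hζ : IsCutoff ζ) (a : ℕ → Fin 3 → ℤ) (ha : IsGoodSeq a)
    (Ctil M : ℝ) (hCtil : 0 < Ctil) (hM : 0 < M)
    (φ u : ℝ × (Fin 3 → ℝ) → ℝ)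
    (hφcont : ContinuousOn φ (OmegaSet ζ a))
    (hφbd : ∀ p ∈ OmegaSet ζ a, 0 ≤ φ p ∧ φ p ≤ Ctil * Real.exp (-(p.1 ^ ((4 : ℝ) / 3))))
    (huper : cylPeriodic3 u)
    (hubd : ∀ p ∈ closure (OmegaSet ζ a), 0 ≤ u p ∧ u p ≤ M)
    (hu0 : ∀ p ∈ frontier (OmegaSet ζ a), u p = 0)
    (hureg : ∃ U : Set (ℝ × (Fin 3 → ℝ)), IsOpen U ∧
      closure (OmegaSet ζ a) ∩ {p : ℝ × (Fin 3 → ℝ) | wseq 2 < p.1} ⊆ U ∧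
      ContDiffOn ℝ 2 u U)
    (hueq : ∀ p ∈ OmegaSet ζ a, wseq 2 < p.1 → -cylLaplacian3 u p = φ p) :
    ∀ p ∈ OmegaSet ζ a, wseq 6 ≤ p.1 →
      u p ≤ 9 * Real.exp 1 / 32 * Ctil * p.1 ^ (-(2 : ℝ) / 3) *
          Real.exp (-(p.1 ^ ((4 : ℝ) / 3))) +
        Real.exp 1 ^ 4 * M * Real.exp (-2 * p.1 ^ ((4 : ℝ) / 3)) := by
  classical
  obtain ⟨U, hU, hΩU, huU⟩ := hureg
  intro p hp hp6
  set Ω := OmegaSet ζ a with hΩ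
  refine le_of_forall_pos_le_add fun δ hδ => ?_
  obtain ⟨ε, hε, hδε⟩ : ∃ ε, 0 < ε ∧ δ = 2 * ε := ⟨δ / 2, by linarith, by ring⟩
  obtain ⟨v, hv, hv0⟩ : ∃ v : ℝ × (Fin 3 → ℝ) → ℝ,
      (∀ y ∈ closure Ω, v y = softPos ε (u y)) ∧ ∀ y ∉ closure Ω, v y = 0 :=
    ⟨fun y => if y ∈ closure Ω then softPos ε (u y) else 0,
      fun y hy => if_pos hy, fun y hy => if_neg hy⟩
  have hlap : ∀ x : ℝ × (Fin 3 → ℝ), wseq 2 < x.1 → ContDiffAt ℝ 2 v x ∧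
      -(Ctil * Real.exp (-(x.1 ^ ((4 : ℝ) / 3)))) ≤ frechetLaplacian v x := fun x hx =>
    contDiffAt_softPos_and_le_frechetLaplacian hε (by positivity) hU huU
      (fun h => hΩU ⟨h, hx⟩) hu0 hv hv0 fun h => by
        have h1 := hueq x h hx
        have h2 := (hφbd x h).2
        linarith
  have hvΩ : ∀ x : ℝ × (Fin 3 → ℝ), 0 < v x → x ∈ Ω := by
    intro x hx
    by_contra hxΩ
    by_cases hxc : x ∈ closure Ω
    · rw [hv x hxc, hu0 x ⟨hxc, fun h => hxΩ (interior_subset h)⟩, softPos_eq_zero hε hε.le] at hx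
      exact hx.false
    · rw [hv0 x hxc] at hx
      exact hx.false
  have hvM : ∀ x, v x ≤ M := by
    intro x
    by_cases hxc : x ∈ closure Ω
    · rw [hv x hxc]
      exact (softPos_le (hubd x hxc).1).trans (hubd x hxc).2
    · rw [hv0 x hxc]
      exact hM.le
  have hA : 3 / 4 * Ctil ≤ 9 * Real.exp 1 / 32 * Ctil := by
    refine mul_le_mul_of_nonneg_right ?_ hCtil.le
    linarith [Real.exp_one_gt_d9]
  have key := le_decay_add_exp hζ ha hCtil hM hA (fun x hx => (hlap x hx).1)
    (fun x _ h => (hvΩ x h).2) hvM (fun x hx => (hlap x hx).2) hp6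
  have hpc := subset_closure hp
  have h1 := le_softPos_add hε (hubd p hpc).1
  rw [← hv p hpc] at h1
  linarith

end
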